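/- arXiv:1903.06331 — 2 statements merged into one kernel-verified Lean document; each statement's English description precedes it below -/
import Mathlib

section
/- Let χ > 0, assume (B) and (init), and let (u, v) be the maximal classical solution of the crime model on Ω̄ × [0, T_max). Let p ∈ (0,1) satisfy p < 1/χ². Then for all T > 0 there exists C(T) > 0 such that, with T̂_max := min{T, T_max} and τ := min{1, T_max/3}, ∫_t^{t+τ} ∫_Ω u^{p+2} ≤ C(T) for all t ∈ (0, T̂_max − τ), and sup_{T>0} C(T) < ∞ if hypothesis (H2) holds. -/
open Real MeasureTheory Filter Topology Set
open scoped ENNReal NNReal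

noncomputable section

/-- Partial derivative of a space-time function in the first (space) variable. -/
def pdx (f : ℝ → ℝ → ℝ) : ℝ → ℝ → ℝ := fun x t => deriv (fun y => f y t) x

/-- Partial derivative of a space-time function in the second (time) variable. -/
def pdt (f : ℝ → ℝ → ℝ) : ℝ → ℝ → ℝ := fun x t => deriv (fun s => f x s) t

/-- The time interval `[0, Tmax)` (with `Tmax ∈ (0,∞]`). -/
def It (Tmax : ℝ≥0∞) : Set ℝ := {t : ℝ | 0 ≤ t ∧ ENNReal.ofReal t < Tmax}

/-- The time interval `(0, Tmax)` (with `Tmax ∈ (0,∞]`). -/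
def It' (Tmax : ℝ≥0∞) : Set ℝ := {t : ℝ | 0 < t ∧ ENNReal.ofReal t < Tmax}

/-- The waiting time `τ := min{1, Tmax/3}`, as a real number. -/
def tauOf (Tmax : ℝ≥0∞) : ℝ := (min 1 (Tmax / 3)).toReal

/-- Hypothesis (B): `B` is nonnegative, bounded, and locally Hölder continuous on
`Ω̄ × [0,∞)` with some exponent `ϑ ∈ (0,1)`. -/
def HypB (a b : ℝ) (B : ℝ → ℝ → ℝ) : Prop :=
  (∀ x t : ℝ, 0 ≤ B x t) ∧ (∃ M : ℝ, ∀ x t : ℝ, B x t ≤ M) ∧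
  ∃ ϑ : ℝ, ϑ ∈ Set.Ioo (0:ℝ) 1 ∧
    ∀ K : Set (ℝ × ℝ), IsCompact K → K ⊆ (Set.Icc a b) ×ˢ (Set.Ici (0:ℝ)) →
      ∃ C : ℝ, ∀ p ∈ K, ∀ q ∈ K, |B p.1 p.2 - B q.1 q.2| ≤ C * dist p q ^ ϑ

/-- Hypothesis (init): `u0 ∈ C⁰(Ω̄)` nonnegative, `v0 ∈ W^{1,∞}(Ω)` (i.e. Lipschitz)
positive on `Ω̄`. -/
def HypInit (a b : ℝ) (u0 v0 : ℝ → ℝ) : Prop :=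
  ContinuousOn u0 (Set.Icc a b) ∧ (∀ x ∈ Set.Icc a b, 0 ≤ u0 x) ∧
  (∃ L : ℝ≥0, LipschitzOnWith L v0 (Set.Icc a b)) ∧ (∀ x ∈ Set.Icc a b, 0 < v0 x)

/-- Hypothesis (H1): `∫_0^∞ ∫_Ω B1 < ∞`. -/
def HypH1 (a b : ℝ) (B1 : ℝ → ℝ → ℝ) : Prop :=
  MeasureTheory.IntegrableOn (fun p : ℝ × ℝ => B1 p.1 p.2)
    ((Set.Ioo a b) ×ˢ (Set.Ioi (0:ℝ)))

/-- Hypothesis (H1'): `∫_t^{t+1} ∫_Ω B1 → 0` as `t → ∞`. -/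
def HypH1' (a b : ℝ) (B1 : ℝ → ℝ → ℝ) : Prop :=
  Filter.Tendsto (fun t : ℝ => ∫ s in t..(t+1), ∫ x in Set.Ioo a b, B1 x s)
    Filter.atTop (nhds 0)

/-- Hypothesis (H2): `inf_{t>0} ∫_Ω B2(·,t) > 0`. -/
def HypH2 (a b : ℝ) (B2 : ℝ → ℝ → ℝ) : Prop :=
  ∃ c : ℝ, 0 < c ∧ ∀ t : ℝ, 0 < t → c ≤ ∫ x in Set.Ioo a b, B2 x t

/-- Hypothesis (H3): `B2(·,t)` stabilizes to `B2inf ∈ L²(Ω)` in the averaged `L²` sense. -/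
def HypH3 (a b : ℝ) (B2 : ℝ → ℝ → ℝ) (B2inf : ℝ → ℝ) : Prop :=
  MeasureTheory.MemLp B2inf 2 (MeasureTheory.volume.restrict (Set.Ioo a b)) ∧
  Filter.Tendsto
    (fun t : ℝ => ∫ s in t..(t+1), ∫ x in Set.Ioo a b, (B2 x s - B2inf x)^2)
    Filter.atTop (nhds 0)

/-- A classical solution of the urban crime system
`u_t = u_xx − χ (u/v · v_x)_x − uv + B1`, `v_t = v_xx + uv − v + B2` on
`Ω̄ × [0, Tmax)`, `Ω = (a,b)`, with homogeneous Neumann boundary conditions and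
initial data `(u0, v0)`; `u, v` are positive on `Ω̄ × (0, Tmax)`, belong to
`C⁰(Ω̄ × [0,Tmax)) ∩ C^{2,1}(Ω̄ × (0,Tmax))` and `v(·,t)` lies in `W^{1,r}(Ω)`,
continuously in `t`, for every `r > 1`. -/
structure CrimeSol (a b χ : ℝ) (B1 B2 : ℝ → ℝ → ℝ) (u0 v0 : ℝ → ℝ)
    (u v : ℝ → ℝ → ℝ) (Tmax : ℝ≥0∞) : Prop where
  u_cont : ContinuousOn (fun p : ℝ × ℝ => u p.1 p.2) ((Set.Icc a b) ×ˢ It Tmax)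
  v_cont : ContinuousOn (fun p : ℝ × ℝ => v p.1 p.2) ((Set.Icc a b) ×ˢ It Tmax)
  u_init : ∀ x ∈ Set.Icc a b, u x 0 = u0 x
  v_init : ∀ x ∈ Set.Icc a b, v x 0 = v0 x
  u_pos : ∀ x ∈ Set.Icc a b, ∀ t ∈ It' Tmax, 0 < u x t
  v_pos : ∀ x ∈ Set.Icc a b, ∀ t ∈ It' Tmax, 0 < v x t
  u_reg : ∀ x ∈ Set.Icc a b, ∀ t ∈ It' Tmax,
    DifferentiableAt ℝ (fun y => u y t) x ∧
    DifferentiableAt ℝ (fun y => pdx u y t) x ∧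
    DifferentiableAt ℝ (fun s => u x s) t
  v_reg : ∀ x ∈ Set.Icc a b, ∀ t ∈ It' Tmax,
    DifferentiableAt ℝ (fun y => v y t) x ∧
    DifferentiableAt ℝ (fun y => pdx v y t) x ∧
    DifferentiableAt ℝ (fun s => v x s) t
  u_cont21 : ContinuousOn
    (fun p : ℝ × ℝ => (pdx u p.1 p.2, pdx (pdx u) p.1 p.2, pdt u p.1 p.2))
    ((Set.Icc a b) ×ˢ It' Tmax)
  v_cont21 : ContinuousOn
    (fun p : ℝ × ℝ => (pdx v p.1 p.2, pdx (pdx v) p.1 p.2, pdt v p.1 p.2))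
    ((Set.Icc a b) ×ˢ It' Tmax)
  v_W1r : ∀ r : ℝ, 1 < r →
    (∀ t ∈ It Tmax,
      MeasureTheory.IntegrableOn (fun x => |pdx v x t| ^ r) (Set.Ioo a b)) ∧
    ContinuousOn (fun t => ∫ x in Set.Ioo a b, |pdx v x t| ^ r) (It Tmax)
  u_eq : ∀ x ∈ Set.Ioo a b, ∀ t ∈ It' Tmax,
    pdt u x t = pdx (pdx u) x t
      - χ * pdx (fun y s => u y s / v y s * pdx v y s) x t
      - u x t * v x t + B1 x t
  v_eq : ∀ x ∈ Set.Ioo a b, ∀ t ∈ It' Tmax,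
    pdt v x t = pdx (pdx v) x t + u x t * v x t - v x t + B2 x t
  u_bc : ∀ t ∈ It' Tmax, pdx u a t = 0 ∧ pdx u b t = 0
  v_bc : ∀ t ∈ It' Tmax, pdx v a t = 0 ∧ pdx v b t = 0

/-- A classical solution of the stationary Neumann problem
`−w'' + w = B` in `Ω = (a,b)`, `w' = 0` on `∂Ω`. -/
def IsStationarySol (a b : ℝ) (B : ℝ → ℝ) (w : ℝ → ℝ) : Prop :=
  ContinuousOn w (Set.Icc a b) ∧
  (∀ x ∈ Set.Icc a b, DifferentiableAt ℝ w x ∧ DifferentiableAt ℝ (deriv w) x) ∧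
  (∀ x ∈ Set.Ioo a b, -(deriv (deriv w) x) + w x = B x) ∧
  deriv w a = 0 ∧ deriv w b = 0

/-- The branches `q^±(p) = (1−p)/2 · (1 ∓/± √(1 − pχ²))`. -/
def qminus (χ p : ℝ) : ℝ := (1 - p) / 2 * (1 - Real.sqrt (1 - p * χ^2))

def qplus (χ p : ℝ) : ℝ := (1 - p) / 2 * (1 + Real.sqrt (1 - p * χ^2))

/-- The auxiliary functions `φ₁, φ₂, φ₃` and the constant `p₀`. -/
def phi1 (p : ℝ) : ℝ := (p + 1) / (1 - p)

def phi2 (χ p : ℝ) : ℝ := (1 - p) / (2 * p) * (1 + Real.sqrt (1 - p * χ^2))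

def phi3 (χ p : ℝ) : ℝ := (1 - p) / (2 * p) * (1 - Real.sqrt (1 - p * χ^2))

def p0 : ℝ := (2 * Real.sqrt 3 - 3) / 3

lemma leib {a b : ℝ} (hab : a < b) {J : Set ℝ} (hJ : IsOpen J) {g gt : ℝ → ℝ → ℝ}
    (hg : ∀ x ∈ Icc a b, ∀ t ∈ J, HasDerivAt (fun s => g x s) (gt x t) t)
    (cg : ContinuousOn (fun z : ℝ × ℝ => g z.1 z.2) (Icc a b ×ˢ J))
    (cgt : ContinuousOn (fun z : ℝ × ℝ => gt z.1 z.2) (Icc a b ×ˢ J)) {t : ℝ} (ht : t ∈ J) :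
    HasDerivAt (fun s => ∫ x in a..b, g x s) (∫ x in a..b, gt x t) t := by
  obtain ⟨δ, hδ, hball⟩ := Metric.nhds_basis_closedBall.mem_iff.1 (hJ.mem_nhds ht)
  have hcomp : IsCompact (Icc a b ×ˢ Metric.closedBall t δ) :=
    isCompact_Icc.prod (isCompact_closedBall t δ)
  obtain ⟨C, hC⟩ := hcomp.exists_bound_of_continuousOn
    (cgt.mono (prod_mono le_rfl hball))
  have slice : ∀ {h : ℝ → ℝ → ℝ}, ContinuousOn (fun z : ℝ × ℝ => h z.1 z.2) (Icc a b ×ˢ J) →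
      ∀ s ∈ J, ContinuousOn (fun x => h x s) (Icc a b) := by
    intro h hh s hs
    exact hh.comp (f := fun x => (x, s)) (by fun_prop) (fun x hx => ⟨hx, hs⟩)
  have hsub : Set.uIoc a b ⊆ Icc a b := by
    rw [uIoc_of_le hab.le]; exact Ioc_subset_Icc_self
  refine (intervalIntegral.hasDerivAt_integral_of_dominated_loc_of_deriv_le
    (F := fun s x => g x s) (F' := fun s x => gt x s) (bound := fun _ => C)
    (Metric.closedBall_mem_nhds t hδ) ?_ ?_ ?_ ?_ ?_ ?_).2
  · filter_upwards [hJ.mem_nhds ht] with s hs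
    exact ((slice cg s hs).mono hsub).aestronglyMeasurable measurableSet_uIoc
  · apply ContinuousOn.intervalIntegrable
    rw [uIcc_of_le hab.le]; exact slice cg t ht
  · exact ((slice cgt t ht).mono hsub).aestronglyMeasurable measurableSet_uIoc
  · refine Eventually.of_forall fun x hx s hs => ?_
    exact hC (x, s) ⟨hsub hx, hs⟩
  · simp
  · refine Eventually.of_forall fun x hx s hs => ?_
    exact hg x (hsub hx) s (hball hs)

lemma cs_int {a b : ℝ} (hab : a < b) {f g : ℝ → ℝ} (hf : ContinuousOn f (Icc a b))
    (hg : ContinuousOn g (Icc a b)) :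
    (∫ x in a..b, f x * g x) ^ 2 ≤ (∫ x in a..b, f x ^ 2) * ∫ x in a..b, g x ^ 2 := by
  have ii : ∀ {h : ℝ → ℝ}, ContinuousOn h (Icc a b) → IntervalIntegrable h volume a b := by
    intro h hh
    apply ContinuousOn.intervalIntegrable
    rwa [uIcc_of_le hab.le]
  have key : ∀ l : ℝ, 0 ≤ (∫ x in a..b, f x ^ 2) * (l * l) + (2 * ∫ x in a..b, f x * g x) * l
      + ∫ x in a..b, g x ^ 2 := by
    intro l
    have h0 : 0 ≤ ∫ x in a..b, (l * f x + g x) ^ 2 :=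
      intervalIntegral.integral_nonneg hab.le (fun x _ => sq_nonneg _)
    have : ∫ x in a..b, (l * f x + g x) ^ 2
        = (∫ x in a..b, f x ^ 2) * (l * l) + (2 * ∫ x in a..b, f x * g x) * l
      + ∫ x in a..b, g x ^ 2 := by
      have e : ∀ x, (l * f x + g x) ^ 2 = (l * l) * f x ^ 2 + (2 * l) * (f x * g x) + g x ^ 2 := by
        intro x; ring
      simp_rw [e]
      rw [intervalIntegral.integral_add, intervalIntegral.integral_add,
        intervalIntegral.integral_const_mul, intervalIntegral.integral_const_mul]
      · ring
      all_goals exact ii (by fun_prop)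
    linarith
  have := discrim_le_zero key
  unfold discrim at this
  nlinarith

lemma osc {a b : ℝ} (hab : a < b) {f α β : ℝ → ℝ} (hα : ContinuousOn α (Icc a b))
    (hβ : ContinuousOn β (Icc a b))
    (hf : ∀ x ∈ Icc a b, HasDerivAt f (α x * β x) x) {x y : ℝ} (hx : x ∈ Icc a b)
    (hy : y ∈ Icc a b) :
    (f x - f y) ^ 2 ≤ (∫ x in a..b, α x ^ 2) * ∫ x in a..b, β x ^ 2 := by
  wlog hxy : y < x generalizing x y
  · rcases eq_or_lt_of_le (not_lt.1 hxy) with h | h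
    · subst h
      simp only [sub_self, ne_eq, OfNat.ofNat_ne_zero, not_false_eq_true, zero_pow]
      exact mul_nonneg (intervalIntegral.integral_nonneg hab.le (fun x _ => sq_nonneg _))
        (intervalIntegral.integral_nonneg hab.le (fun x _ => sq_nonneg _))
    · have := this hy hx h
      nlinarith
  have hs : Icc y x ⊆ Icc a b := Icc_subset_Icc hy.1 hx.2
  have h1 : ∫ s in y..x, α s * β s = f x - f y := by
    apply intervalIntegral.integral_eq_sub_of_hasDerivAt
    · intro s hs'; rw [uIcc_of_le hxy.le] at hs'; exact hf s (hs hs')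
    · apply ContinuousOn.intervalIntegrable
      rw [uIcc_of_le hxy.le]; exact (hα.mul hβ).mono hs
  have mono : ∀ {h : ℝ → ℝ}, ContinuousOn h (Icc a b) →
      ∫ s in y..x, h s ^ 2 ≤ ∫ s in a..b, h s ^ 2 := by
    intro h hh
    apply intervalIntegral.integral_mono_interval hy.1 hxy.le hx.2
    · exact Eventually.of_forall fun s => sq_nonneg _
    · apply ContinuousOn.intervalIntegrable
      rw [uIcc_of_le hab.le]; exact hh.pow 2
  rw [← h1]
  refine (cs_int hxy (hα.mono hs) (hβ.mono hs)).trans ?_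
  exact mul_le_mul (mono hα) (mono hβ)
    (intervalIntegral.integral_nonneg hxy.le (fun x _ => sq_nonneg _))
    (intervalIntegral.integral_nonneg hab.le (fun x _ => sq_nonneg _))

/-- linear differential inequality -/
lemma ode_le {y y' : ℝ → ℝ} {s t k A : ℝ} (hst : s ≤ t)
    (hy : ∀ r ∈ Icc s t, HasDerivAt y (y' r) r) (hle : ∀ r ∈ Icc s t, y' r ≤ -k * (y r - A)) :
    y t - A ≤ (y s - A) * exp (-k * (t - s)) := by
  have hd : ∀ r ∈ Icc s t, HasDerivAt (fun r => (y r - A) * exp (k * r))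
      (y' r * exp (k * r) + (y r - A) * (exp (k * r) * k)) r := by
    intro r hr
    have h2 : HasDerivAt (fun r => exp (k * r)) (exp (k * r) * k) r := by
      have := ((hasDerivAt_id r).const_mul k).exp
      simpa using this
    exact ((hy r hr).sub_const A).mul h2
  have anti : AntitoneOn (fun r => (y r - A) * exp (k * r)) (Icc s t) := by
    apply antitoneOn_of_hasDerivWithinAt_nonpos (convex_Icc s t)
      (fun r hr => (hd r hr).continuousAt.continuousWithinAt)
      (fun r hr => (hd r (interior_subset hr)).hasDerivWithinAt)
    intro r hr
    have := hle r (interior_subset hr)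
    nlinarith [exp_pos (k * r)]
  have h := anti (left_mem_Icc.2 hst) (right_mem_Icc.2 hst) hst
  simp only at h
  have e : exp (-k * (t - s)) = exp (k * s) * (exp (k * t))⁻¹ := by
    rw [← exp_neg, ← exp_add]; congr 1; ring
  rw [e, ← mul_assoc, ← div_eq_mul_inv, le_div_iff₀ (exp_pos _)]
  exact h

structure Sys (a b χ M : ℝ) (J : Set ℝ) where
  u : ℝ → ℝ → ℝ
  ux : ℝ → ℝ → ℝ
  uxx : ℝ → ℝ → ℝ
  ut : ℝ → ℝ → ℝ
  v : ℝ → ℝ → ℝ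
  vx : ℝ → ℝ → ℝ
  vxx : ℝ → ℝ → ℝ
  vt : ℝ → ℝ → ℝ
  Ru : ℝ → ℝ → ℝ
  Rv : ℝ → ℝ → ℝ
  hab : a < b
  hJ : IsOpen J
  hJc : J.OrdConnected
  cu : ContinuousOn (fun z : ℝ × ℝ => u z.1 z.2) (Icc a b ×ˢ J)
  cux : ContinuousOn (fun z : ℝ × ℝ => ux z.1 z.2) (Icc a b ×ˢ J)
  cuxx : ContinuousOn (fun z : ℝ × ℝ => uxx z.1 z.2) (Icc a b ×ˢ J)
  cut : ContinuousOn (fun z : ℝ × ℝ => ut z.1 z.2) (Icc a b ×ˢ J)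
  cv : ContinuousOn (fun z : ℝ × ℝ => v z.1 z.2) (Icc a b ×ˢ J)
  cvx : ContinuousOn (fun z : ℝ × ℝ => vx z.1 z.2) (Icc a b ×ˢ J)
  cvxx : ContinuousOn (fun z : ℝ × ℝ => vxx z.1 z.2) (Icc a b ×ˢ J)
  cvt : ContinuousOn (fun z : ℝ × ℝ => vt z.1 z.2) (Icc a b ×ˢ J)
  du : ∀ x ∈ Icc a b, ∀ t ∈ J, HasDerivAt (fun y => u y t) (ux x t) x
  ddu : ∀ x ∈ Icc a b, ∀ t ∈ J, HasDerivAt (fun y => ux y t) (uxx x t) x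
  dtu : ∀ x ∈ Icc a b, ∀ t ∈ J, HasDerivAt (fun s => u x s) (ut x t) t
  dv : ∀ x ∈ Icc a b, ∀ t ∈ J, HasDerivAt (fun y => v y t) (vx x t) x
  ddv : ∀ x ∈ Icc a b, ∀ t ∈ J, HasDerivAt (fun y => vx y t) (vxx x t) x
  dtv : ∀ x ∈ Icc a b, ∀ t ∈ J, HasDerivAt (fun s => v x s) (vt x t) t
  upos : ∀ x ∈ Icc a b, ∀ t ∈ J, 0 < u x t
  vpos : ∀ x ∈ Icc a b, ∀ t ∈ J, 0 < v x t
  ubc : ∀ t ∈ J, ux a t = 0 ∧ ux b t = 0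
  vbc : ∀ t ∈ J, vx a t = 0 ∧ vx b t = 0
  hRu : ∀ x t, Ru x t = ut x t - uxx x t + χ * (ux x t * vx x t / v x t
      + u x t * vxx x t / v x t - u x t * vx x t ^ 2 / v x t ^ 2) + u x t * v x t
  hRv : ∀ x t, Rv x t = vt x t - vxx x t - u x t * v x t + v x t
  Ru0 : ∀ x ∈ Icc a b, ∀ t ∈ J, 0 ≤ Ru x t
  RuM : ∀ x ∈ Icc a b, ∀ t ∈ J, Ru x t ≤ M
  Rv0 : ∀ x ∈ Icc a b, ∀ t ∈ J, 0 ≤ Rv x t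
  RvM : ∀ x ∈ Icc a b, ∀ t ∈ J, Rv x t ≤ M

noncomputable section

namespace Sys

variable {a b χ M : ℝ} {J : Set ℝ}

def Q (S : Sys a b χ M J) (p q x t : ℝ) : ℝ :=
  S.u x t ^ p * S.v x t ^ q *
    (p * (1 - p) * (S.ux x t / S.u x t) ^ 2 + q * (1 - q + p * χ) * (S.vx x t / S.v x t) ^ 2
      - p * (2 * q + (1 - p) * χ) * (S.ux x t / S.u x t) * (S.vx x t / S.v x t)
      - p * S.v x t + p * (S.Ru x t / S.u x t) + q * S.u x t - q + q * (S.Rv x t / S.v x t))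

def E (S : Sys a b χ M J) (p q t : ℝ) : ℝ := ∫ x in a..b, S.u x t ^ p * S.v x t ^ q

lemma slice {h : ℝ → ℝ → ℝ} {t : ℝ}
    (hh : ContinuousOn (fun z : ℝ × ℝ => h z.1 z.2) (Icc a b ×ˢ J)) (ht : t ∈ J) :
    ContinuousOn (fun x => h x t) (Icc a b) :=
  hh.comp (f := fun x => (x, t)) (by fun_prop) (fun x hx => ⟨hx, ht⟩)

lemma ii (hab : a < b) {h : ℝ → ℝ} (hh : ContinuousOn h (Icc a b)) :
    IntervalIntegrable h volume a b := by
  apply ContinuousOn.intervalIntegrable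
  rwa [uIcc_of_le hab.le]

lemma sRu (S : Sys a b χ M J) {t : ℝ} (ht : t ∈ J) :
    ContinuousOn (fun x => S.Ru x t) (Icc a b) := by
  have h1 := slice S.cu ht
  have h2 := slice S.cux ht
  have h3 := slice S.cuxx ht
  have h4 := slice S.cut ht
  have h5 := slice S.cv ht
  have h6 := slice S.cvx ht
  have h7 := slice S.cvxx ht
  have hv : ∀ x ∈ Icc a b, S.v x t ≠ 0 := fun x hx => (S.vpos x hx t ht).ne'
  have hv2 : ∀ x ∈ Icc a b, S.v x t ^ 2 ≠ 0 := fun x hx => pow_ne_zero 2 (hv x hx)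
  simp_rw [S.hRu]
  exact ((h4.sub h3).add (continuousOn_const.mul ((((h2.mul h6).div h5 hv).add
    ((h1.mul h7).div h5 hv)).sub ((h1.mul (h6.pow 2)).div (h5.pow 2) hv2)))).add (h1.mul h5)

lemma sRv (S : Sys a b χ M J) {t : ℝ} (ht : t ∈ J) :
    ContinuousOn (fun x => S.Rv x t) (Icc a b) := by
  have h1 := slice S.cu ht
  have h5 := slice S.cv ht
  have h7 := slice S.cvxx ht
  have h8 := slice S.cvt ht
  simp_rw [S.hRv]
  fun_prop

lemma spow {f : ℝ → ℝ} (hf : ContinuousOn f (Icc a b)) (hp : ∀ x ∈ Icc a b, 0 < f x) (p : ℝ) :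
    ContinuousOn (fun x => f x ^ p) (Icc a b) :=
  hf.rpow_const (fun x hx => Or.inl (hp x hx).ne')

lemma cont_uv (S : Sys a b χ M J) (p q : ℝ) {t : ℝ} (ht : t ∈ J) :
    ContinuousOn (fun x => S.u x t ^ p * S.v x t ^ q) (Icc a b) :=
  (spow (slice S.cu ht) (fun x hx => S.upos x hx t ht) p).mul
    (spow (slice S.cv ht) (fun x hx => S.vpos x hx t ht) q)

lemma cont_Q (S : Sys a b χ M J) (p q : ℝ) {t : ℝ} (ht : t ∈ J) :
    ContinuousOn (fun x => S.Q p q x t) (Icc a b) := by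
  have h0 := S.cont_uv p q ht
  have h1 := slice S.cu ht
  have h5 := slice S.cv ht
  have hu : ∀ x ∈ Icc a b, S.u x t ≠ 0 := fun x hx => (S.upos x hx t ht).ne'
  have hv : ∀ x ∈ Icc a b, S.v x t ≠ 0 := fun x hx => (S.vpos x hx t ht).ne'
  have h2 := (slice S.cux ht).div h1 hu
  have h6 := (slice S.cvx ht).div h5 hv
  have h8 := (S.sRu ht).div h1 hu
  have h9 := (S.sRv ht).div h5 hv
  unfold Q
  have k : ∀ c : ℝ, ContinuousOn (fun _ : ℝ => c) (Icc a b) := fun c => continuousOn_const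
  exact h0.mul ((((((((k _).mul (h2.pow 2)).add ((k _).mul (h6.pow 2))).sub
    (((k _).mul h2).mul h6)).sub ((k _).mul h5)).add ((k _).mul h8)).add ((k _).mul h1)).sub
    (k _) |>.add ((k _).mul h9))

lemma hasDeriv (S : Sys a b χ M J) (p q : ℝ) {t : ℝ} (ht : t ∈ J) :
    HasDerivAt (S.E p q) (∫ x in a..b, S.Q p q x t) t := by
  have cpow : ∀ {f : ℝ → ℝ → ℝ}, ContinuousOn (fun z : ℝ × ℝ => f z.1 z.2) (Icc a b ×ˢ J) →
      (∀ x ∈ Icc a b, ∀ t ∈ J, 0 < f x t) → ∀ p : ℝ,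
      ContinuousOn (fun z : ℝ × ℝ => f z.1 z.2 ^ p) (Icc a b ×ˢ J) := fun hf hp p =>
    hf.rpow_const (fun z hz => Or.inl (hp z.1 hz.1 z.2 hz.2).ne')
  have hU := cpow S.cu S.upos p
  have hV := cpow S.cv S.vpos q
  have dpow : ∀ {f : ℝ → ℝ} {f' x : ℝ} (r : ℝ), HasDerivAt f f' x → 0 < f x →
      HasDerivAt (fun y => f y ^ r) (f x ^ r * (r * (f' / f x))) x := by
    intro f f' x r hf hx
    have := hf.rpow_const (p := r) (Or.inl hx.ne')
    rw [rpow_sub_one hx.ne'] at this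
    convert this using 1
    field_simp
  have hL := leib S.hab S.hJ (g := fun x s => S.u x s ^ p * S.v x s ^ q)
    (gt := fun x s => S.u x s ^ p * S.v x s ^ q *
      (p * (S.ut x s / S.u x s) + q * (S.vt x s / S.v x s)))
    (by
      intro x hx s hs
      have h1 := dpow p (S.dtu x hx s hs) (S.upos x hx s hs)
      have h2 := dpow q (S.dtv x hx s hs) (S.vpos x hx s hs)
      refine (h1.mul h2).congr_deriv ?_
      ring)
    (hU.mul hV)
    ((hU.mul hV).mul ((continuousOn_const.mul (S.cut.div S.cu
        (fun z hz => (S.upos z.1 hz.1 z.2 hz.2).ne'))).add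
      (continuousOn_const.mul (S.cvt.div S.cv (fun z hz => (S.vpos z.1 hz.1 z.2 hz.2).ne'))))) ht
  have h0 := S.cont_uv p q ht
  have h1 := slice S.cu ht
  have h5 := slice S.cv ht
  have hu : ∀ x ∈ Icc a b, S.u x t ≠ 0 := fun x hx => (S.upos x hx t ht).ne'
  have hv : ∀ x ∈ Icc a b, S.v x t ≠ 0 := fun x hx => (S.vpos x hx t ht).ne'
  have h2 := (slice S.cux ht).div h1 hu
  have h3 := (slice S.cuxx ht).div h1 hu
  have h6 := (slice S.cvx ht).div h5 hv
  have h7 := (slice S.cvxx ht).div h5 hv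
  let H' : ℝ → ℝ := fun x => S.u x t ^ p * S.v x t ^ q *
    ((p * (S.ux x t / S.u x t) + q * (S.vx x t / S.v x t)) *
      (p * (S.ux x t / S.u x t) + (q - p * χ) * (S.vx x t / S.v x t)) +
      (p * (S.uxx x t / S.u x t - (S.ux x t / S.u x t) ^ 2)
        + (q - p * χ) * (S.vxx x t / S.v x t - (S.vx x t / S.v x t) ^ 2)))
  have hH'c : ContinuousOn H' (Icc a b) := by
    have k : ∀ c : ℝ, ContinuousOn (fun _ : ℝ => c) (Icc a b) := fun c => continuousOn_const
    exact h0.mul (((((k p).mul h2).add ((k q).mul h6)).mul (((k p).mul h2).add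
      ((k (q - p * χ)).mul h6))).add (((k p).mul (h3.sub (h2.pow 2))).add
      ((k (q - p * χ)).mul (h7.sub (h6.pow 2)))))
  have hH : ∫ x in a..b, H' x = 0 := by
    rw [intervalIntegral.integral_eq_sub_of_hasDerivAt
      (f := fun x => S.u x t ^ p * S.v x t ^ q *
        (p * (S.ux x t / S.u x t) + (q - p * χ) * (S.vx x t / S.v x t))) _ (ii S.hab hH'c)]
    · simp [S.ubc t ht, S.vbc t ht]
    · intro x hx
      rw [uIcc_of_le S.hab.le] at hx
      have e1 := dpow p (S.du x hx t ht) (S.upos x hx t ht)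
      have e2 := dpow q (S.dv x hx t ht) (S.vpos x hx t ht)
      have e3 := (S.ddu x hx t ht).div (S.du x hx t ht) (hu x hx)
      have e4 := (S.ddv x hx t ht).div (S.dv x hx t ht) (hv x hx)
      have e5 := (e1.mul e2).mul ((e3.const_mul p).add (e4.const_mul (q - p * χ)))
      refine e5.congr_deriv ?_
      simp only [H', Pi.mul_apply, Pi.add_apply, Pi.div_apply]
      have := hu x hx
      have := hv x hx
      field_simp
  have hgt : ContinuousOn (fun x => S.Q p q x t + H' x) (Icc a b) :=
    (S.cont_Q p q ht).add hH'c
  have : ∫ x in a..b, S.Q p q x t = ∫ x in a..b, (S.u x t ^ p * S.v x t ^ q *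
      (p * (S.ut x t / S.u x t) + q * (S.vt x t / S.v x t))) := by
    have e : ∫ x in a..b, (S.Q p q x t + H' x) = ∫ x in a..b, S.Q p q x t := by
      rw [intervalIntegral.integral_add (ii S.hab (S.cont_Q p q ht)) (ii S.hab hH'c), hH, add_zero]
    rw [← e]
    apply intervalIntegral.integral_congr
    intro x hx
    rw [uIcc_of_le S.hab.le] at hx
    have := hu x hx
    have := hv x hx
    simp only [H', Q, S.hRu, S.hRv]
    rw [← mul_add]
    congr 1
    field_simp
    ring
  rw [this]
  exact hL

end Sys
end

noncomputable section

namespace Sys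

variable {a b χ M : ℝ} {J : Set ℝ}

lemma imono (hab : a < b) {f g : ℝ → ℝ} (hf : ContinuousOn f (Icc a b))
    (hg : ContinuousOn g (Icc a b)) (h : ∀ x ∈ Icc a b, f x ≤ g x) :
    ∫ x in a..b, f x ≤ ∫ x in a..b, g x :=
  intervalIntegral.integral_mono_on hab.le (ii hab hf) (ii hab hg) h

lemma ile (hab : a < b) {f : ℝ → ℝ} {c : ℝ} (hf : ContinuousOn f (Icc a b))
    (h : ∀ x ∈ Icc a b, f x ≤ c) : ∫ x in a..b, f x ≤ (b - a) * c := by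
  have := imono hab hf (continuousOn_const (c := c)) h
  simpa using this

lemma ige (hab : a < b) {f : ℝ → ℝ} {c : ℝ} (hf : ContinuousOn f (Icc a b))
    (h : ∀ x ∈ Icc a b, c ≤ f x) : (b - a) * c ≤ ∫ x in a..b, f x := by
  have := imono hab (continuousOn_const (c := c)) hf h
  simpa using this

lemma Q_low (S : Sys a b χ M J) (r x t : ℝ) : S.Q 0 (-r) x t = S.v x t ^ (-r) *
    (-(r * (1 + r)) * (S.vx x t / S.v x t) ^ 2 - r * S.u x t + r - r * (S.Rv x t / S.v x t)) := by
  simp only [Q, rpow_zero]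
  ring

lemma comparison (S : Sys a b χ M J) {s t c : ℝ} (hs : s ∈ J) (ht : t ∈ J) (hst : s ≤ t)
    (hc : 0 < c) (hv : ∀ x ∈ Icc a b, c ≤ S.v x s) :
    ∀ x ∈ Icc a b, c * exp (-(t - s)) ≤ S.v x t := by
  intro x hx
  by_contra hlt
  push Not at hlt
  set m := c * exp (-(t - s)) with hm
  have hmpos : 0 < m := by positivity
  obtain ⟨m', hm'1, hm'2⟩ := exists_between hlt
  have hm'pos : 0 < m' := (S.vpos x hx t ht).trans hm'1
  have hup : ∀ n : ℕ, S.E 0 (-(n : ℝ)) t ≤ (b - a) * m ^ (-(n : ℝ)) := by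
    intro n
    have h1 := ode_le (y := S.E 0 (-(n : ℝ))) (k := -(n : ℝ)) (A := 0) hst
      (fun r hr => S.hasDeriv 0 (-(n : ℝ)) (S.hJc.out hs ht hr)) (by
        intro r hr
        have hr := S.hJc.out hs ht hr
        have : -(-(n : ℝ)) * (S.E 0 (-(n : ℝ)) r - 0)
            = ∫ x in a..b, (n : ℝ) * (S.u x r ^ (0 : ℝ) * S.v x r ^ (-(n : ℝ))) := by
          rw [intervalIntegral.integral_const_mul, E]; ring
        rw [this]
        apply imono S.hab (S.cont_Q _ _ hr) (continuousOn_const.mul (S.cont_uv _ _ hr))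
        intro y hy
        simp only [Pi.mul_apply]
        rw [Q_low]
        have a1 := S.upos y hy r hr
        have a2 := S.vpos y hy r hr
        have a3 := S.Rv0 y hy r hr
        have a4 : 0 < S.v y r ^ (-(n : ℝ)) := rpow_pos_of_pos a2 _
        have a5 : 0 ≤ (n : ℝ) * (1 + n) * (S.vx y r / S.v y r) ^ 2 := by positivity
        have a6 : 0 ≤ (n : ℝ) * (S.Rv y r / S.v y r) := by positivity
        have a7 : 0 ≤ (n : ℝ) * S.u y r := by positivity
        rw [rpow_zero, one_mul, mul_comm (n : ℝ) (S.v y r ^ (-(n : ℝ)))]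
        apply mul_le_mul_of_nonneg_left _ a4.le
        linarith)
    have h2 : S.E 0 (-(n : ℝ)) s ≤ (b - a) * c ^ (-(n : ℝ)) := by
      apply ile S.hab (S.cont_uv _ _ hs)
      intro y hy
      rw [rpow_zero, one_mul]
      exact rpow_le_rpow_of_nonpos hc (hv y hy) (by simp)
    have h3 : m ^ (-(n : ℝ)) = c ^ (-(n : ℝ)) * exp (- -(n : ℝ) * (t - s)) := by
      rw [hm, mul_rpow hc.le (exp_pos _).le, ← exp_mul]
      congr 2; ring
    rw [h3]
    rw [sub_zero, sub_zero] at h1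
    refine h1.trans ?_
    rw [← mul_assoc]
    exact mul_le_mul_of_nonneg_right h2 (exp_pos _).le
  have hcont := (S.dv x hx t ht).continuousAt
  obtain ⟨ε, hε, hball⟩ := Metric.eventually_nhds_iff.1 (hcont.eventually (gt_mem_nhds hm'1))
  set α := max a (x - ε / 2)
  set β := min b (x + ε / 2)
  have hαβ : α < β := by
    have := S.hab
    have := hx.1
    have := hx.2
    exact max_lt (lt_min S.hab (by linarith)) (lt_min (by linarith) (by linarith))
  have haα : a ≤ α := le_max_left _ _
  have hβb : β ≤ b := min_le_left _ _
  have hlow : ∀ n : ℕ, (β - α) * m' ^ (-(n : ℝ)) ≤ S.E 0 (-(n : ℝ)) t := by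
    intro n
    have h1 : (β - α) * m' ^ (-(n : ℝ)) ≤ ∫ y in α..β, S.u y t ^ (0 : ℝ) * S.v y t ^ (-(n : ℝ)) := by
      apply ige hαβ ((S.cont_uv _ _ ht).mono (Icc_subset_Icc haα hβb))
      intro y hy
      rw [rpow_zero, one_mul]
      have hy' : y ∈ Icc a b := Icc_subset_Icc haα hβb hy
      refine rpow_le_rpow_of_nonpos (S.vpos y hy' t ht) ?_ (by simp)
      refine (hball ?_).le
      rw [Real.dist_eq, abs_lt]
      have := (le_max_right a (x - ε / 2)).trans hy.1
      have := hy.2.trans (min_le_right b (x + ε / 2))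
      constructor <;> linarith
    refine h1.trans ?_
    apply intervalIntegral.integral_mono_interval haα hαβ.le hβb
    · rw [EventuallyLE, ae_restrict_iff' measurableSet_Ioc]
      refine Eventually.of_forall fun y hy => ?_
      have hy := Ioc_subset_Icc_self hy
      exact mul_nonneg (rpow_nonneg (S.upos y hy t ht).le _) (rpow_nonneg (S.vpos y hy t ht).le _)
    · exact ii S.hab (S.cont_uv _ _ ht)
  have h1 : 1 < m / m' := (one_lt_div hm'pos).2 hm'2
  obtain ⟨n, hn⟩ := pow_unbounded_of_one_lt ((b - a) / (β - α)) h1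
  have h2 := (hlow n).trans (hup n)
  rw [rpow_neg hm'pos.le, rpow_neg hmpos.le, rpow_natCast, rpow_natCast] at h2
  rw [div_pow, div_lt_div_iff₀ (sub_pos.2 hαβ) (by positivity)] at hn
  rw [← div_eq_mul_inv, ← div_eq_mul_inv, div_le_div_iff₀ (by positivity) (by positivity)] at h2
  nlinarith

lemma low_ineq (S : Sys a b χ M J) {r c t : ℝ} (hr : r = 1 / (b - a)) (hc : 0 < c) (ht : t ∈ J)
    (hR : c ≤ ∫ x in a..b, S.Rv x t) :
    (∫ x in a..b, S.Q 0 (-r) x t) ≤ - r * S.E 0 (-r) t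
      - r ^ 2 * (∫ x in a..b, S.v x t ^ (-r) * (S.vx x t / S.v x t) ^ 2)
      + r * (4 * (b - a) * (c / (4 * (b - a))) ^ (-r)) ∧
    ∀ x ∈ Icc a b, S.v x t ^ (-r) ≤ 2 * S.E 0 (-r) t / (b - a) +
      (∫ x in a..b, S.v x t ^ (-r) * (S.vx x t / S.v x t) ^ 2) / (2 * (b - a)) := by
  have hl : 0 < b - a := sub_pos.2 S.hab
  have hrpos : 0 < r := by rw [hr]; positivity
  have hrl : r * (b - a) = 1 := by rw [hr]; field_simp
  have cv := slice S.cv ht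
  have vp : ∀ x ∈ Icc a b, 0 < S.v x t := fun x hx => S.vpos x hx t ht
  have cq : ContinuousOn (fun x => S.vx x t / S.v x t) (Icc a b) :=
    (slice S.cvx ht).div cv (fun x hx => (vp x hx).ne')
  set G := ∫ x in a..b, S.v x t ^ (-r) * (S.vx x t / S.v x t) ^ 2 with hG
  have hG0 : 0 ≤ G := intervalIntegral.integral_nonneg S.hab.le (fun x hx =>
    mul_nonneg (rpow_nonneg (vp x hx).le _) (sq_nonneg _))
  obtain ⟨x1, hx1, hmax⟩ := isCompact_Icc.exists_isMaxOn (nonempty_Icc.2 S.hab.le) cv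
  have hmax : ∀ x ∈ Icc a b, S.v x t ≤ S.v x1 t := fun x hx => hmax hx
  set m := S.v x1 t with hm
  have hmp : 0 < m := vp x1 hx1
  have sqr : ∀ x ∈ Icc a b, (S.v x t ^ (-r / 2)) ^ 2 = S.v x t ^ (-r) := by
    intro x hx
    rw [← rpow_natCast, ← rpow_mul (vp x hx).le]
    congr 1; push_cast; ring
  have hosc : ∀ x ∈ Icc a b, S.v x t ^ (-r) ≤ 2 * m ^ (-r) + G * r / 2 := by
    intro x hx
    have h := osc S.hab (f := fun x => S.v x t ^ (-r / 2))
      (α := fun x => S.v x t ^ (-r / 2) * (S.vx x t / S.v x t)) (β := fun _ => - r / 2)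
      ((spow cv vp _).mul cq) continuousOn_const (by
        intro y hy
        have := (S.dv y hy t ht).rpow_const (p := -r / 2) (Or.inl (vp y hy).ne')
        rw [rpow_sub_one (vp y hy).ne'] at this
        refine this.congr_deriv ?_
        have := (vp y hy).ne'
        field_simp) hx hx1
    have e1 : ∫ x in a..b, (S.v x t ^ (-r / 2) * (S.vx x t / S.v x t)) ^ 2 = G := by
      apply intervalIntegral.integral_congr
      intro y hy
      rw [uIcc_of_le S.hab.le] at hy
      simp only
      rw [mul_pow, sqr y hy]
    have e2 : ∫ x in a..b, (- r / 2) ^ 2 = r / 4 := by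
      rw [intervalIntegral.integral_const, smul_eq_mul]
      linear_combination r / 4 * hrl
    rw [e1, e2] at h
    rw [← sqr x hx, hm, ← sqr x1 hx1]
    nlinarith [sq_nonneg (S.v x t ^ (-r / 2) - 2 * S.v x1 t ^ (-r / 2))]
  have hE : S.E 0 (-r) t ≤ 2 * (b - a) * m ^ (-r) + G / 2 := by
    have : S.E 0 (-r) t ≤ (b - a) * (2 * m ^ (-r) + G * r / 2) := by
      apply ile S.hab (S.cont_uv _ _ ht)
      intro x hx
      rw [rpow_zero, one_mul]
      exact hosc x hx
    refine this.trans (le_of_eq ?_)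
    linear_combination G / 2 * hrl
  have hE2 : (b - a) * m ^ (-r) ≤ S.E 0 (-r) t := by
    apply ige S.hab (S.cont_uv _ _ ht)
    intro x hx
    rw [rpow_zero, one_mul]
    exact rpow_le_rpow_of_nonpos (vp x hx) (hmax x hx) (by linarith)
  constructor
  · have h1 : (∫ x in a..b, S.Q 0 (-r) x t) ≤ ∫ x in a..b,
        ((-(r * (1 + r)) * (S.v x t ^ (-r) * (S.vx x t / S.v x t) ^ 2)
        + r * (S.u x t ^ (0 : ℝ) * S.v x t ^ (-r))) - r * (m ^ (-r) / m) * S.Rv x t) := by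
      apply imono S.hab (S.cont_Q _ _ ht) (((continuousOn_const.mul ((spow cv vp _).mul
        (cq.pow 2))).add (continuousOn_const.mul (S.cont_uv _ _ ht))).sub
        (continuousOn_const.mul (S.sRv ht)))
      intro x hx
      simp only [Pi.mul_apply, Pi.sub_apply, Pi.add_apply, Pi.pow_apply]
      rw [Q_low, rpow_zero]
      have a1 := S.upos x hx t ht
      have a2 := vp x hx
      have a3 := S.Rv0 x hx t ht
      have a4 : 0 < S.v x t ^ (-r) := rpow_pos_of_pos a2 _
      have a5 : m ^ (-r) / m ≤ S.v x t ^ (-r) / S.v x t :=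
        div_le_div₀ a4.le (rpow_le_rpow_of_nonpos a2 (hmax x hx) (by linarith)) a2 (hmax x hx)
      have a6 : r * (m ^ (-r) / m) * S.Rv x t ≤ r * (S.v x t ^ (-r) / S.v x t) * S.Rv x t := by
        gcongr
      have a7 : 0 ≤ S.v x t ^ (-r) * (r * S.u x t) := by positivity
      have a8 : r * (S.v x t ^ (-r) / S.v x t) * S.Rv x t
        = S.v x t ^ (-r) * (r * (S.Rv x t / S.v x t)) := by ring
      linarith
    rw [intervalIntegral.integral_sub, intervalIntegral.integral_add,
      intervalIntegral.integral_const_mul, intervalIntegral.integral_const_mul,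
      intervalIntegral.integral_const_mul, ← hG] at h1
    rotate_left
    · exact ii S.hab (continuousOn_const.mul ((spow cv vp _).mul (cq.pow 2)))
    · exact ii S.hab (continuousOn_const.mul (S.cont_uv _ _ ht))
    · exact ii S.hab ((continuousOn_const.mul ((spow cv vp _).mul
        (cq.pow 2))).add (continuousOn_const.mul (S.cont_uv _ _ ht)))
    · exact ii S.hab (continuousOn_const.mul (S.sRv ht))
    change _ ≤ _ + r * S.E 0 (-r) t - _ at h1
    have hmr : 0 < m ^ (-r) := rpow_pos_of_pos hmp _
    have h2 : m ^ (-r) / m * c ≤ m ^ (-r) / m * ∫ x in a..b, S.Rv x t :=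
      mul_le_mul_of_nonneg_left hR (by positivity)
    have h3 : 4 * (b - a) * m ^ (-r) - m ^ (-r) / m * c
        ≤ 4 * (b - a) * (c / (4 * (b - a))) ^ (-r) := by
      have hc4 : 0 < c / (4 * (b - a)) := by positivity
      rcases le_total m (c / (4 * (b - a))) with h | h
      · have : 4 * (b - a) * m ^ (-r) - m ^ (-r) / m * c ≤ 0 := by
          rw [le_div_iff₀ (by positivity)] at h
          have e : 4 * (b - a) * m ^ (-r) - m ^ (-r) / m * c
            = m ^ (-r) / m * (m * (4 * (b - a)) - c) := by field_simp
          rw [e]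
          exact mul_nonpos_of_nonneg_of_nonpos (by positivity) (by linarith)
        exact this.trans (by positivity)
      · have h4 : m ^ (-r) ≤ (c / (4 * (b - a))) ^ (-r) :=
          rpow_le_rpow_of_nonpos hc4 h (by linarith)
        have h5 : 0 ≤ m ^ (-r) / m * c := by positivity
        nlinarith
    nlinarith [mul_le_mul_of_nonneg_left hE hrpos.le, mul_le_mul_of_nonneg_left h2 hrpos.le,
      mul_le_mul_of_nonneg_left h3 hrpos.le]
  · intro x hx
    refine (hosc x hx).trans ?_
    have e : G / (2 * (b - a)) = G * r / 2 := by rw [hr]; field_simp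
    rw [e, mul_div_assoc 2]
    have : m ^ (-r) ≤ S.E 0 (-r) t / (b - a) := by
      rw [le_div_iff₀ hl]; linarith
    linarith

/-- uniform lower bound under (H2), after time `t0` -/
lemma lower_H2 (S : Sys a b χ M J) {c t0 : ℝ} (hc : 0 < c) (ht0 : t0 ∈ J)
    (hR : ∀ t ∈ J, c ≤ ∫ x in a..b, S.Rv x t) :
    ∃ d : ℝ, 0 < d ∧ ∀ t ∈ J, t0 ≤ t → ∀ x ∈ Icc a b, d ≤ S.v x t := by
  have hl : 0 < b - a := sub_pos.2 S.hab
  obtain ⟨r, hr⟩ : ∃ r, r = 1 / (b - a) := ⟨_, rfl⟩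
  have hrpos : 0 < r := by rw [hr]; positivity
  have key := fun t (ht : t ∈ J) => S.low_ineq hr hc ht (hR t ht)
  set C0 := 4 * (b - a) * (c / (4 * (b - a))) ^ (-r) with hC0
  have hC0p : 0 < C0 := by positivity
  have hE0 : ∀ t ∈ J, 0 ≤ S.E 0 (-r) t := fun t ht =>
    intervalIntegral.integral_nonneg S.hab.le (fun x hx =>
      mul_nonneg (rpow_nonneg (S.upos x hx t ht).le _) (rpow_nonneg (S.vpos x hx t ht).le _))
  have hG0 : ∀ t ∈ J, 0 ≤ ∫ x in a..b, S.v x t ^ (-r) * (S.vx x t / S.v x t) ^ 2 := fun t ht =>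
    intervalIntegral.integral_nonneg S.hab.le (fun x hx =>
      mul_nonneg (rpow_nonneg (S.vpos x hx t ht).le _) (sq_nonneg _))
  set Y := S.E 0 (-r) t0 + C0 with hY
  have hYp : 0 < Y := by have := hE0 t0 ht0; linarith
  have hEY : ∀ t ∈ J, t0 ≤ t → S.E 0 (-r) t ≤ Y := by
    intro t ht h0t
    have h := ode_le (y := S.E 0 (-r)) (k := r) (A := C0) h0t
      (fun s hs => S.hasDeriv 0 (-r) (S.hJc.out ht0 ht hs)) (by
        intro s hs
        have hs := S.hJc.out ht0 ht hs
        have h1 := (key s hs).1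
        have h2 := mul_nonneg (sq_nonneg r) (hG0 s hs)
        linarith)
    have h2 : exp (-r * (t - t0)) ≤ 1 := by
      rw [exp_le_one_iff]; nlinarith
    have h3 := exp_pos (-r * (t - t0))
    have h4 := hE0 t0 ht0
    nlinarith
  -- constants
  set Gm := (r * C0 + Y) / r ^ 2 with hGm
  set W := 2 * Y / (b - a) + Gm / (2 * (b - a)) with hW
  have hWp : 0 < W := by positivity
  obtain ⟨x0, hx0, hmin⟩ := isCompact_Icc.exists_isMinOn (nonempty_Icc.2 S.hab.le)
    (slice S.cv ht0)
  have hmin : ∀ x ∈ Icc a b, S.v x0 t0 ≤ S.v x t0 := fun x hx => hmin hx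
  have hm0 := S.vpos x0 hx0 t0 ht0
  refine ⟨min (S.v x0 t0 * exp (-1)) (W ^ (-(1 / r)) * exp (-1)), by positivity, ?_⟩
  intro t ht h0t x hx
  rcases le_total t (t0 + 1) with h | h
  · refine (min_le_left _ _).trans (le_trans ?_ (S.comparison ht0 ht h0t hm0 hmin x hx))
    gcongr
    linarith
  · have ht1 : t - 1 ∈ J := S.hJc.out ht0 ht ⟨by linarith, by linarith⟩
    have hsub : Icc (t - 1) t ⊆ J := S.hJc.out ht1 ht
    obtain ⟨s, hs, hslope⟩ := exists_hasDerivAt_eq_slope (S.E 0 (-r))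
      (fun s => ∫ x in a..b, S.Q 0 (-r) x s) (show t - 1 < t by linarith)
      (fun s hs => (S.hasDeriv 0 (-r) (hsub hs)).continuousAt.continuousWithinAt)
      (fun s hs => S.hasDeriv 0 (-r) (hsub (Ioo_subset_Icc_self hs)))
    have hsJ := hsub (Ioo_subset_Icc_self hs)
    have h0s : t0 ≤ s := by have := hs.1; linarith
    have hden : t - (t - 1) = 1 := by ring
    rw [hden, div_one] at hslope
    have k1 := hE0 t ht
    have k2 := hEY (t - 1) ht1 (by linarith)
    have k3 := (key s hsJ).1
    have k4 := hE0 s hsJ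
    have k5 := hEY s hsJ h0s
    have hGle : (∫ x in a..b, S.v x s ^ (-r) * (S.vx x s / S.v x s) ^ 2) ≤ Gm := by
      rw [hGm, le_div_iff₀ (by positivity)]
      nlinarith
    have hlow : ∀ y ∈ Icc a b, W ^ (-(1 / r)) ≤ S.v y s := by
      intro y hy
      have vp := S.vpos y hy s hsJ
      have h1 : S.v y s ^ (-r) ≤ W := by
        refine ((key s hsJ).2 y hy).trans ?_
        rw [hW]
        gcongr
      have h2 := rpow_le_rpow_of_nonpos (rpow_pos_of_pos vp (-r)) h1
        (show -(1 / r) ≤ 0 by have : 0 < 1 / r := by positivity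
                              linarith)
      rw [← rpow_mul vp.le] at h2
      have e : -r * -(1 / r) = 1 := by field_simp
      rwa [e, rpow_one] at h2
    refine (min_le_right _ _).trans (le_trans ?_ (S.comparison hsJ ht hs.2.le
      (rpow_pos_of_pos hWp _) hlow x hx))
    gcongr
    linarith [hs.1]

end Sys
end

noncomputable section

namespace Sys

variable {a b χ M : ℝ} {J : Set ℝ}

lemma gn (hab : a < b) {f f' : ℝ → ℝ} {p K : ℝ} (hp0 : 0 < p) (hp1 : p < 1)
    (hf : ∀ x ∈ Icc a b, HasDerivAt f (f' x) x) (cf' : ContinuousOn f' (Icc a b))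
    (fp : ∀ x ∈ Icc a b, 0 < f x) (hK : ∫ x in a..b, f x ≤ K) :
    ∫ x in a..b, f x ^ (p + 2) ≤ K * (2 * (K / (b - a)) ^ (p + 1)) +
      2 * K ^ 2 * ∫ x in a..b, f x ^ p * (f' x / f x) ^ 2 := by
  have hl : 0 < b - a := sub_pos.2 hab
  have cf : ContinuousOn f (Icc a b) := fun x hx => (hf x hx).continuousAt.continuousWithinAt
  have cq : ContinuousOn (fun x => f' x / f x) (Icc a b) := cf'.div cf (fun x hx => (fp x hx).ne')
  set G := ∫ x in a..b, f x ^ p * (f' x / f x) ^ 2 with hG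
  have hG0 : 0 ≤ G := intervalIntegral.integral_nonneg hab.le (fun x hx =>
    mul_nonneg (rpow_nonneg (fp x hx).le _) (sq_nonneg _))
  obtain ⟨x1, hx1, hmin⟩ := isCompact_Icc.exists_isMinOn (nonempty_Icc.2 hab.le) cf
  have hmin : ∀ x ∈ Icc a b, f x1 ≤ f x := fun x hx => hmin hx
  have hm : (b - a) * f x1 ≤ K := (ige hab cf hmin).trans hK
  have hm' : f x1 ≤ K / (b - a) := by rw [le_div_iff₀ hl]; linarith
  have f1 := fp x1 hx1
  have hK0 : 0 < K := lt_of_lt_of_le (mul_pos hl f1) hm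
  have sqr : ∀ r : ℝ, ∀ x ∈ Icc a b, (f x ^ (r / 2)) ^ 2 = f x ^ r := by
    intro r x hx
    rw [← rpow_natCast, ← rpow_mul (fp x hx).le]
    congr 1; push_cast; ring
  have hsup : ∀ x ∈ Icc a b, f x ^ (p + 1) ≤ 2 * (K / (b - a)) ^ (p + 1) + 2 * K * G := by
    intro x hx
    have h := osc hab (f := fun x => f x ^ ((p + 1) / 2))
      (α := fun x => f x ^ ((1 : ℝ) / 2))
      (β := fun x => ((p + 1) / 2) * (f x ^ (p / 2) * (f' x / f x)))
      (spow cf fp _) (continuousOn_const.fun_mul ((spow cf fp _).mul cq)) (by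
        intro y hy
        have := (hf y hy).rpow_const (p := (p + 1) / 2) (Or.inl (fp y hy).ne')
        rw [rpow_sub_one (fp y hy).ne'] at this
        refine this.congr_deriv ?_
        have e : f y ^ ((p + 1) / 2) = f y ^ ((1 : ℝ) / 2) * f y ^ (p / 2) := by
          rw [← rpow_add (fp y hy)]; congr 1; ring
        rw [e]
        ring) hx hx1
    have e1 : ∫ x in a..b, (f x ^ ((1 : ℝ) / 2)) ^ 2 = ∫ x in a..b, f x := by
      apply intervalIntegral.integral_congr
      intro y hy
      rw [uIcc_of_le hab.le] at hy
      simp only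
      rw [sqr 1 y hy, rpow_one]
    have e2 : ∫ x in a..b, (((p + 1) / 2) * (f x ^ (p / 2) * (f' x / f x))) ^ 2
        = ((p + 1) / 2) ^ 2 * G := by
      rw [hG, ← intervalIntegral.integral_const_mul]
      apply intervalIntegral.integral_congr
      intro y hy
      rw [uIcc_of_le hab.le] at hy
      simp only
      rw [mul_pow, mul_pow, sqr p y hy]
    rw [e1, e2] at h
    have h3 : ((p + 1) / 2) ^ 2 * G ≤ G := by
      have : ((p + 1) / 2) ^ 2 ≤ 1 := by nlinarith
      nlinarith
    have h4 : (∫ x in a..b, f x) * (((p + 1) / 2) ^ 2 * G) ≤ K * G :=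
      mul_le_mul hK h3 (by positivity) hK0.le
    have h5 : f x1 ^ (p + 1) ≤ (K / (b - a)) ^ (p + 1) :=
      rpow_le_rpow f1.le hm' (by linarith)
    rw [← sqr (p + 1) x1 hx1] at h5
    rw [← sqr (p + 1) x hx]
    nlinarith [sq_nonneg (f x ^ ((p + 1) / 2) - 2 * f x1 ^ ((p + 1) / 2))]
  set B := 2 * (K / (b - a)) ^ (p + 1) + 2 * K * G with hB
  have hB0 : 0 ≤ B := by positivity
  have h1 : ∫ x in a..b, f x ^ (p + 2) ≤ ∫ x in a..b, B * f x := by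
    apply imono hab (spow cf fp _) (continuousOn_const.fun_mul cf)
    intro x hx
    have e : f x ^ (p + 2) = f x ^ (p + 1) * f x := by
      rw [← rpow_add_one (fp x hx).ne']; congr 1; ring
    rw [e]
    exact mul_le_mul_of_nonneg_right (hsup x hx) (fp x hx).le
  rw [intervalIntegral.integral_const_mul] at h1
  refine h1.trans ((mul_le_mul_of_nonneg_left hK hB0).trans (le_of_eq ?_))
  rw [hB]; ring

lemma E_nonneg (S : Sys a b χ M J) (p q : ℝ) {t : ℝ} (ht : t ∈ J) : 0 ≤ S.E p q t :=
  intervalIntegral.integral_nonneg S.hab.le (fun x hx =>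
    mul_nonneg (rpow_nonneg (S.upos x hx t ht).le _) (rpow_nonneg (S.vpos x hx t ht).le _))

lemma E_u (S : Sys a b χ M J) (p t : ℝ) : S.E p 0 t = ∫ x in a..b, S.u x t ^ p := by
  simp [E]

lemma E_v (S : Sys a b χ M J) (p t : ℝ) : S.E 0 p t = ∫ x in a..b, S.v x t ^ p := by
  simp [E]

lemma int_Q10 (S : Sys a b χ M J) {t : ℝ} (ht : t ∈ J) :
    (∫ x in a..b, S.Q 1 0 x t) = (∫ x in a..b, S.Ru x t) - ∫ x in a..b, S.u x t * S.v x t := by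
  rw [← intervalIntegral.integral_sub (ii S.hab (S.sRu ht))
    (ii S.hab ((slice S.cu ht).fun_mul (slice S.cv ht)))]
  apply intervalIntegral.integral_congr
  intro x hx
  rw [uIcc_of_le S.hab.le] at hx
  have := (S.upos x hx t ht).ne'
  simp only [Q, rpow_one, rpow_zero]
  field_simp
  ring

lemma int_Q01 (S : Sys a b χ M J) {t : ℝ} (ht : t ∈ J) :
    (∫ x in a..b, S.Q 0 1 x t) = (∫ x in a..b, S.Rv x t) + (∫ x in a..b, S.u x t * S.v x t)
      - ∫ x in a..b, S.v x t := by
  have c1 := ii S.hab (S.sRv ht)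
  have c2 := ii S.hab ((slice S.cu ht).fun_mul (slice S.cv ht))
  have c3 : IntervalIntegrable (fun x => S.Rv x t + S.u x t * S.v x t) volume a b := c1.add c2
  rw [← intervalIntegral.integral_add c1 c2, ← intervalIntegral.integral_sub c3
    (ii S.hab (slice S.cv ht))]
  apply intervalIntegral.integral_congr
  intro x hx
  rw [uIcc_of_le S.hab.le] at hx
  have := (S.vpos x hx t ht).ne'
  simp only [Q, rpow_one, rpow_zero]
  field_simp
  ring

lemma mass (S : Sys a b χ M J) {d t0 : ℝ} (hM : 0 ≤ M) (hd : 0 < d) (ht0 : t0 ∈ J)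
    (hv : ∀ t ∈ J, ∀ x ∈ Icc a b, d ≤ S.v x t) :
    ∃ K : ℝ, ∀ t ∈ J, t0 ≤ t → S.E 1 0 t ≤ K ∧ S.E 0 1 t ≤ K := by
  have hl : 0 < b - a := sub_pos.2 S.hab
  set A := (b - a) * M / d with hA
  have hA0 : 0 ≤ A := by positivity
  have hu : ∀ t ∈ J, t0 ≤ t → S.E 1 0 t ≤ S.E 1 0 t0 + A := by
    intro t ht h0t
    have h := ode_le (y := S.E 1 0) (k := d) (A := A) h0t
      (fun s hs => S.hasDeriv 1 0 (S.hJc.out ht0 ht hs)) (by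
        intro s hs
        have hs := S.hJc.out ht0 ht hs
        rw [S.int_Q10 hs, S.E_u]
        have h1 : ∫ x in a..b, S.Ru x s ≤ (b - a) * M :=
          ile S.hab (S.sRu hs) (fun x hx => S.RuM x hx s hs)
        have h2 : ∫ x in a..b, d * S.u x s ≤ ∫ x in a..b, S.u x s * S.v x s := by
          apply imono S.hab (continuousOn_const.fun_mul (slice S.cu hs))
            ((slice S.cu hs).fun_mul (slice S.cv hs))
          intro x hx
          have := S.upos x hx s hs
          have := hv s hs x hx
          nlinarith
        rw [intervalIntegral.integral_const_mul] at h2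
        have h3 : d * A = (b - a) * M := by rw [hA]; field_simp
        simp only [rpow_one]
        linarith)
    have h2 : exp (-d * (t - t0)) ≤ 1 := by
      rw [exp_le_one_iff]; nlinarith
    have h3 := exp_pos (-d * (t - t0))
    have h4 := S.E_nonneg 1 0 ht0
    nlinarith
  set A2 := 2 * ((b - a) * M) + (S.E 1 0 t0 + A) with hA2
  have hA20 : 0 ≤ A2 := by have := S.E_nonneg 1 0 ht0; positivity
  have hv2 : ∀ t ∈ J, t0 ≤ t → S.E 1 0 t + S.E 0 1 t ≤ S.E 1 0 t0 + S.E 0 1 t0 + A2 := by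
    intro t ht h0t
    have h := ode_le (y := fun s => S.E 1 0 s + S.E 0 1 s) (k := 1) (A := A2) h0t
      (fun s hs => (S.hasDeriv 1 0 (S.hJc.out ht0 ht hs)).add
        (S.hasDeriv 0 1 (S.hJc.out ht0 ht hs))) (by
        intro s hs'
        have hs := S.hJc.out ht0 ht hs'
        have h0 := hu s hs hs'.1
        rw [S.int_Q10 hs, S.int_Q01 hs]
        have h1 : ∫ x in a..b, S.Ru x s ≤ (b - a) * M :=
          ile S.hab (S.sRu hs) (fun x hx => S.RuM x hx s hs)
        have h2 : ∫ x in a..b, S.Rv x s ≤ (b - a) * M :=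
          ile S.hab (S.sRv hs) (fun x hx => S.RvM x hx s hs)
        have h3 : S.E 0 1 s = ∫ x in a..b, S.v x s := by simp [E_v]
        linarith)
    have h2 : exp (-1 * (t - t0)) ≤ 1 := by
      rw [exp_le_one_iff]; nlinarith
    have h3 := exp_pos (-1 * (t - t0))
    have h4 := S.E_nonneg 1 0 ht0
    have h5 := S.E_nonneg 0 1 ht0
    nlinarith
  refine ⟨S.E 1 0 t0 + S.E 0 1 t0 + A2, fun t ht h0t => ?_⟩
  have h1 := hv2 t ht h0t
  have h2 := S.E_nonneg 1 0 ht
  have h3 := S.E_nonneg 0 1 ht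
  constructor <;> linarith

set_option maxHeartbeats 1000000 in
lemma main (S : Sys a b χ M J) {d K p : ℝ} (hχ : 0 < χ) (hM : 0 ≤ M) (hd : 0 < d)
    (hp0 : 0 < p) (hp1 : p < 1) (hpχ : p * χ ^ 2 < 1) (hK0 : 0 ≤ K)
    (hv : ∀ t ∈ J, ∀ x ∈ Icc a b, d ≤ S.v x t)
    (hKu : ∀ t ∈ J, S.E 1 0 t ≤ K) (hKv : ∀ t ∈ J, S.E 0 1 t ≤ K) :
    ∃ C : ℝ, 0 < C ∧ ∀ t1 ∈ J, ∀ t2 ∈ J, t1 ≤ t2 → t2 - t1 ≤ 1 →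
      ∫ t in t1..t2, S.E (p + 2) 0 t ≤ C := by
  have hl : 0 < b - a := sub_pos.2 S.hab
  obtain ⟨q, hq⟩ : ∃ q, q = (1 - p) / 2 := ⟨_, rfl⟩
  have hq0 : 0 < q := by rw [hq]; linarith
  set A := p * (1 - p) with hA
  set B := q * (1 - q + p * χ) with hB
  set D := p * (2 * q + (1 - p) * χ) with hD
  have hA0 : 0 < A := mul_pos hp0 (by linarith)
  have hB0 : 0 < B := by
    apply mul_pos hq0
    have : 0 < p * χ := by positivity
    rw [hq]; linarith
  set ε := A - D ^ 2 / (4 * B) with hε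
  have hε0 : 0 < ε := by
    rw [hε, sub_pos, div_lt_iff₀ (by positivity)]
    have e : A * (4 * B) - D ^ 2 = p * (1 - p) ^ 2 * (1 - p * χ ^ 2) := by
      rw [hA, hB, hD, hq]; ring
    have : 0 < p * (1 - p) ^ 2 * (1 - p * χ ^ 2) := by
      have : 0 < 1 - p := by linarith
      have : 0 < 1 - p * χ ^ 2 := by linarith
      positivity
    linarith
  have hquad : ∀ X Y : ℝ, ε * X ^ 2 ≤ A * X ^ 2 + B * Y ^ 2 - D * X * Y := by
    intro X Y
    have e : A * X ^ 2 + B * Y ^ 2 - D * X * Y - ε * X ^ 2 = B * (Y - D / (2 * B) * X) ^ 2 := by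
      rw [hε]; field_simp; ring
    have : 0 ≤ B * (Y - D / (2 * B) * X) ^ 2 := by positivity
    linarith
  -- elementary inequalities
  have young1 : ∀ y : ℝ, 0 < y → y ^ p ≤ 1 + y := by
    intro y hy
    have := geom_mean_le_arith_mean2_weighted hp0.le (show 0 ≤ 1 - p by linarith) hy.le zero_le_one
      (by ring)
    rw [one_rpow] at this
    nlinarith
  have young2 : ∀ y z : ℝ, 0 < y → 0 < z → y ^ p * z ^ q ≤ 1 + y + z := by
    intro y z hy hz
    have hpq : 0 ≤ 1 - p - q := by rw [hq]; linarith
    have := geom_mean_le_arith_mean3_weighted hp0.le hq0.le hpq hy.le hz.le zero_le_one (by ring)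
    rw [one_rpow] at this
    have h1 : p * y ≤ y := by nlinarith
    have h2 : q * z ≤ z := by nlinarith
    linarith
  have young3 : ∀ y z : ℝ, 0 < y → 0 < z → y ^ p * z ^ q * z ≤ y * z + (1 + z ^ (p + 2)) := by
    intro y z hy hz
    have h1 := geom_mean_le_arith_mean2_weighted hp0.le (show 0 ≤ 1 - p by linarith)
      (mul_pos hy hz).le (rpow_pos_of_pos hz (3 / 2)).le (by ring)
    have e : (y * z) ^ p * (z ^ ((3 : ℝ) / 2)) ^ (1 - p) = y ^ p * z ^ q * z := by
      rw [mul_rpow hy.le hz.le, ← rpow_mul hz.le, mul_assoc, ← rpow_add hz, mul_assoc,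
        ← rpow_add_one hz.ne']
      congr 2; rw [hq]; ring
    have h2 : z ^ ((3 : ℝ) / 2) ≤ 1 + z ^ (p + 2) := by
      rcases le_total z 1 with h | h
      · have := rpow_le_one hz.le h (show (0 : ℝ) ≤ 3 / 2 by norm_num)
        have := rpow_pos_of_pos hz (p + 2)
        linarith
      · have := rpow_le_rpow_of_exponent_le h (show (3 : ℝ) / 2 ≤ p + 2 by linarith)
        linarith
    rw [e] at h1
    have h3 : 0 < z ^ ((3 : ℝ) / 2) := rpow_pos_of_pos hz _
    have h4 : 0 < y * z := mul_pos hy hz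
    nlinarith
  -- constants
  set c1 := K * (2 * (K / (b - a)) ^ (p + 1)) with hc1
  set c2 := 2 * K ^ 2 with hc2
  have hc10 : 0 ≤ c1 := by positivity
  have hc20 : 0 ≤ c2 := by positivity
  have hdq : 0 < d ^ q := rpow_pos_of_pos hd q
  set K1 := (b - a) + K with hK1
  set K2 := (b - a) + K + K with hK2
  have E0p : ∀ t ∈ J, S.E 0 p t ≤ K1 := by
    intro t ht
    have h1 : S.E 0 p t ≤ ∫ x in a..b, (1 + S.v x t) := by
      apply imono S.hab (S.cont_uv _ _ ht) (continuousOn_const.fun_add (slice S.cv ht))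
      intro x hx
      rw [rpow_zero, one_mul]
      exact young1 _ (S.vpos x hx t ht)
    rw [intervalIntegral.integral_add (by simp) (ii S.hab (slice S.cv ht))] at h1
    have h2 := hKv t ht
    rw [E_v] at h2
    simp only [rpow_one] at h2
    simp at h1
    linarith
  have Epq : ∀ t ∈ J, S.E p q t ≤ K2 := by
    intro t ht
    have h1 : S.E p q t ≤ ∫ x in a..b, (1 + S.u x t + S.v x t) := by
      apply imono S.hab (S.cont_uv _ _ ht)
        ((continuousOn_const.fun_add (slice S.cu ht)).fun_add (slice S.cv ht))
      intro x hx
      exact young2 _ _ (S.upos x hx t ht) (S.vpos x hx t ht)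
    rw [intervalIntegral.integral_add
      (ii S.hab (continuousOn_const.fun_add (slice S.cu ht))) (ii S.hab (slice S.cv ht)),
      intervalIntegral.integral_add (by simp) (ii S.hab (slice S.cu ht))] at h1
    have h2 := hKv t ht
    have h3 := hKu t ht
    rw [E_v] at h2
    rw [E_u] at h3
    simp only [rpow_one] at h2 h3
    simp at h1
    linarith
  set lam := c2 / (ε * d ^ q) with hlam
  set mu := c2 / A with hmu
  have hlam0 : 0 ≤ lam := by positivity
  have hmu0 : 0 ≤ mu := by positivity
  set Cst := c1 + lam * (p * ((b - a) * M + (b - a) + c1 + mu * (p * K1)) + q * K2) with hCst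
  have hCst0 : 0 ≤ Cst := by positivity
  -- pointwise-in-time estimate
  have hpt : ∀ t ∈ J, S.E (p + 2) 0 t ≤ lam * ((∫ x in a..b, S.Q p q x t)
      - p * (∫ x in a..b, S.Q 1 0 x t) + p * mu * ∫ x in a..b, S.Q 0 p x t) + Cst := by
    intro t ht
    have up : ∀ x ∈ Icc a b, 0 < S.u x t := fun x hx => S.upos x hx t ht
    have vp : ∀ x ∈ Icc a b, 0 < S.v x t := fun x hx => S.vpos x hx t ht
    have cu := slice S.cu ht
    have cv := slice S.cv ht
    have cqu : ContinuousOn (fun x => S.ux x t / S.u x t) (Icc a b) :=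
      (slice S.cux ht).div cu (fun x hx => (up x hx).ne')
    have cqv : ContinuousOn (fun x => S.vx x t / S.v x t) (Icc a b) :=
      (slice S.cvx ht).div cv (fun x hx => (vp x hx).ne')
    have cGu : ContinuousOn (fun x => S.u x t ^ p * (S.ux x t / S.u x t) ^ 2) (Icc a b) :=
      (spow cu up p).mul (cqu.pow 2)
    have cGv : ContinuousOn (fun x => S.v x t ^ p * (S.vx x t / S.v x t) ^ 2) (Icc a b) :=
      (spow cv vp p).mul (cqv.pow 2)
    set Gu := ∫ x in a..b, S.u x t ^ p * (S.ux x t / S.u x t) ^ 2 with hGu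
    set Gv := ∫ x in a..b, S.v x t ^ p * (S.vx x t / S.v x t) ^ 2 with hGv
    have hKu' := hKu t ht
    have hKv' := hKv t ht
    rw [E_u] at hKu'
    rw [E_v] at hKv'
    simp only [rpow_one] at hKu' hKv'
    have g1 : ∫ x in a..b, S.u x t ^ (p + 2) ≤ c1 + c2 * Gu :=
      gn S.hab hp0 hp1 (fun x hx => S.du x hx t ht) (slice S.cux ht) up hKu'
    have g2 : ∫ x in a..b, S.v x t ^ (p + 2) ≤ c1 + c2 * Gv :=
      gn S.hab hp0 hp1 (fun x hx => S.dv x hx t ht) (slice S.cvx ht) vp hKv'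
    -- v-dissipation
    have i1 : A * Gv ≤ (∫ x in a..b, S.Q 0 p x t) + p * S.E 0 p t := by
      rw [hGv, E, ← intervalIntegral.integral_const_mul, ← intervalIntegral.integral_const_mul,
        ← intervalIntegral.integral_add (ii S.hab (S.cont_Q _ _ ht))
          (ii S.hab (continuousOn_const.fun_mul (S.cont_uv _ _ ht)))]
      apply imono S.hab (continuousOn_const.fun_mul cGv)
        ((S.cont_Q _ _ ht).fun_add (continuousOn_const.fun_mul (S.cont_uv _ _ ht)))
      intro x hx
      simp only [Q, rpow_zero]
      have a1 := up x hx
      have a2 := vp x hx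
      have a3 := S.Rv0 x hx t ht
      have a4 : 0 < S.v x t ^ p := rpow_pos_of_pos a2 _
      have a5 : 0 ≤ S.v x t ^ p * (p * S.u x t) := by positivity
      have a6 : 0 ≤ S.v x t ^ p * (p * (S.Rv x t / S.v x t)) := by positivity
      rw [hA]
      linarith
    -- u-dissipation
    have cw : ContinuousOn (fun x => S.u x t * S.v x t) (Icc a b) := cu.mul cv
    have cz : ContinuousOn (fun x => 1 + S.v x t ^ (p + 2)) (Icc a b) :=
      continuousOn_const.fun_add (spow cv vp _)
    have i2 : ε * d ^ q * Gu ≤ (∫ x in a..b, S.Q p q x t) +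
        p * ((∫ x in a..b, S.u x t * S.v x t) + ∫ x in a..b, (1 + S.v x t ^ (p + 2)))
        + q * S.E p q t := by
      rw [hGu, E, ← intervalIntegral.integral_add (ii S.hab cw) (ii S.hab cz),
        ← intervalIntegral.integral_const_mul, ← intervalIntegral.integral_const_mul,
        ← intervalIntegral.integral_const_mul,
        ← intervalIntegral.integral_add (ii S.hab (S.cont_Q _ _ ht))
          (ii S.hab (continuousOn_const.fun_mul (cw.fun_add cz))),
        ← intervalIntegral.integral_add (ii S.hab ((S.cont_Q _ _ ht).fun_add
          (continuousOn_const.fun_mul (cw.fun_add cz))))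
          (ii S.hab (continuousOn_const.fun_mul (S.cont_uv _ _ ht)))]
      apply imono S.hab (continuousOn_const.fun_mul cGu)
        (((S.cont_Q _ _ ht).fun_add (continuousOn_const.fun_mul (cw.fun_add cz))).fun_add
          (continuousOn_const.fun_mul (S.cont_uv _ _ ht)))
      intro x hx
      simp only [Q]
      have a1 := up x hx
      have a2 := vp x hx
      have a3 := S.Rv0 x hx t ht
      have a3' := S.Ru0 x hx t ht
      have a4 : 0 < S.v x t ^ q := rpow_pos_of_pos a2 _
      have a4' : 0 < S.u x t ^ p := rpow_pos_of_pos a1 _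
      have b1 := young3 _ _ a1 a2
      have b2 := hquad (S.ux x t / S.u x t) (S.vx x t / S.v x t)
      have b3 : d ^ q ≤ S.v x t ^ q := rpow_le_rpow hd.le (hv t ht x hx) hq0.le
      set U := S.u x t ^ p
      set V := S.v x t ^ q
      have a5 : 0 ≤ U * V * (q * S.u x t) := by positivity
      have a6 : 0 ≤ U * V * (q * (S.Rv x t / S.v x t)) := by positivity
      have a7 : 0 ≤ U * V * (p * (S.Ru x t / S.u x t)) := by positivity
      have b4 := mul_le_mul_of_nonneg_left b2 (mul_pos a4' a4).le
      have b5 : ε * d ^ q * (U * (S.ux x t / S.u x t) ^ 2) ≤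
          U * V * (ε * (S.ux x t / S.u x t) ^ 2) := by
        have : 0 ≤ ε * (U * (S.ux x t / S.u x t) ^ 2) := by positivity
        nlinarith [mul_le_mul_of_nonneg_right b3 this]
      have b6 := mul_le_mul_of_nonneg_left b1 hp0.le
      linarith
    have i3 : (∫ x in a..b, (1 + S.v x t ^ (p + 2))) =
        (b - a) + ∫ x in a..b, S.v x t ^ (p + 2) := by
      rw [intervalIntegral.integral_add (by simp) (ii S.hab (spow cv vp _))]
      simp
    have i4 := S.int_Q10 ht
    have i5 : ∫ x in a..b, S.Ru x t ≤ (b - a) * M :=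
      ile S.hab (S.sRu ht) (fun x hx => S.RuM x hx t ht)
    have i6 := E0p t ht
    have i7 := Epq t ht
    rw [E_u]
    have j1 : c2 * Gv ≤ mu * ((∫ x in a..b, S.Q 0 p x t) + p * K1) := by
      have : c2 * Gv = mu * (A * Gv) := by rw [hmu]; field_simp
      rw [this]
      apply mul_le_mul_of_nonneg_left _ hmu0
      refine i1.trans ?_
      gcongr
    have j2 : c2 * Gu = lam * (ε * d ^ q * Gu) := by rw [hlam]; field_simp
    have j3 : ε * d ^ q * Gu ≤ (∫ x in a..b, S.Q p q x t) + p * ((b - a) * M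
        - (∫ x in a..b, S.Q 1 0 x t) + ((b - a) + (c1 + mu * ((∫ x in a..b, S.Q 0 p x t) + p * K1))))
        + q * K2 := by
      refine i2.trans ?_
      have m1 : (∫ x in a..b, S.u x t * S.v x t) ≤ (b - a) * M - ∫ x in a..b, S.Q 1 0 x t := by
        rw [i4]; linarith only [i5]
      have m2 : (∫ x in a..b, (1 + S.v x t ^ (p + 2))) ≤
          (b - a) + (c1 + mu * ((∫ x in a..b, S.Q 0 p x t) + p * K1)) := by
        rw [i3]; linarith only [g2, j1]
      gcongr
    have j4 := mul_le_mul_of_nonneg_left j3 hlam0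
    refine g1.trans ?_
    rw [j2]
    refine (add_le_add_right j4 c1).trans (le_of_eq ?_)
    rw [hCst]
    ring
  refine ⟨lam * (K2 + p * K + p * mu * K1) + Cst + 1, by positivity, ?_⟩
  intro t1 h1 t2 h2 h12 hle
  have hsub : Icc t1 t2 ⊆ J := S.hJc.out h1 h2
  have hder : ∀ t ∈ J, HasDerivAt (fun t => lam * (S.E p q t - p * S.E 1 0 t
      + p * mu * S.E 0 p t) + Cst * t) (lam * ((∫ x in a..b, S.Q p q x t)
      - p * (∫ x in a..b, S.Q 1 0 x t) + p * mu * ∫ x in a..b, S.Q 0 p x t) + Cst) t := by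
    intro t ht
    have := (((S.hasDeriv p q ht).sub ((S.hasDeriv 1 0 ht).const_mul p)).add
      ((S.hasDeriv 0 p ht).const_mul (p * mu))).const_mul lam
    refine (this.add ((hasDerivAt_id t).const_mul Cst)).congr_deriv ?_
    ring
  have hfin := intervalIntegral.integral_le_sub_of_hasDeriv_right_of_le h12
    (fun t ht => (hder t (hsub ht)).continuousAt.continuousWithinAt)
    (fun t ht => (hder t (hsub (Ioo_subset_Icc_self ht))).hasDerivWithinAt)
    (φ := S.E (p + 2) 0)
    (ContinuousOn.integrableOn_Icc (fun t ht =>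
      (S.hasDeriv (p + 2) 0 (hsub ht)).continuousAt.continuousWithinAt))
    (fun t ht => hpt t (hsub (Ioo_subset_Icc_self ht)))
  refine hfin.trans ?_
  have k1 := Epq t2 h2
  have k2 := E0p t2 h2
  have k3 := hKu t1 h1
  have n1 := S.E_nonneg p q h1
  have n2 := S.E_nonneg 0 p h1
  have n3 := S.E_nonneg 1 0 h2
  have e1 : Cst * t2 - Cst * t1 ≤ Cst := by nlinarith
  have e2 : (S.E p q t2 - p * S.E 1 0 t2 + p * mu * S.E 0 p t2)
      - (S.E p q t1 - p * S.E 1 0 t1 + p * mu * S.E 0 p t1) ≤ K2 + p * K + p * mu * K1 := by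
    have pm : 0 ≤ p * mu := by positivity
    have := mul_le_mul_of_nonneg_left k2 pm
    have := mul_nonneg pm n2
    have := mul_le_mul_of_nonneg_left k3 hp0.le
    have := mul_nonneg hp0.le n3
    linarith
  have e3 := mul_le_mul_of_nonneg_left e2 hlam0
  linarith

end Sys
end

noncomputable section

lemma ext_bd {a b M : ℝ} (hab : a < b) {f : ℝ → ℝ} (hf : ContinuousOn f (Icc a b))
    (h : ∀ x ∈ Ioo a b, f x ∈ Icc 0 M) : ∀ x ∈ Icc a b, f x ∈ Icc 0 M := by
  intro x hx
  have hc : closure (Ioo a b) = Icc a b := closure_Ioo hab.ne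
  have h1 : f '' closure (Ioo a b) ⊆ closure (f '' Ioo a b) :=
    ContinuousOn.image_closure (by rwa [hc])
  have h2 : closure (f '' Ioo a b) ⊆ Icc 0 M :=
    closure_minimal (by rintro _ ⟨y, hy, rfl⟩; exact h y hy) isClosed_Icc
  exact h2 (h1 ⟨x, by rwa [hc], rfl⟩)

lemma ItP_open (T : ℝ≥0∞) : IsOpen (It' T) :=
  isOpen_Ioi.inter (isOpen_Iio.preimage ENNReal.continuous_ofReal)

lemma ItP_conn (T : ℝ≥0∞) : (It' T).OrdConnected := by
  constructor
  intro x hx y hy z hz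
  exact ⟨hx.1.trans_le hz.1, (ENNReal.ofReal_le_ofReal hz.2).trans_lt hy.2⟩

lemma ItP_mono {S T : ℝ≥0∞} (h : S ≤ T) : It' S ⊆ It' T := fun _ hx => ⟨hx.1, hx.2.trans_le h⟩

lemma ItP_sub (T : ℝ≥0∞) : It' T ⊆ It T := fun _ hx => ⟨hx.1.le, hx.2⟩

lemma ItP_ne {T : ℝ≥0∞} (h : 0 < T) : ∃ t, t ∈ It' T := by
  obtain ⟨r, h1, h2⟩ := ENNReal.lt_iff_exists_nnreal_btwn.1 h
  refine ⟨r, ?_, ?_⟩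
  · exact_mod_cast h1
  · simpa using h2

/-- The zero order source in the first equation. -/
def srcU (χ : ℝ) (u v : ℝ → ℝ → ℝ) (x t : ℝ) : ℝ :=
  pdt u x t - pdx (pdx u) x t + χ * (pdx u x t * pdx v x t / v x t
      + u x t * pdx (pdx v) x t / v x t - u x t * pdx v x t ^ 2 / v x t ^ 2) + u x t * v x t

/-- The zero order source in the second equation. -/
def srcV (u v : ℝ → ℝ → ℝ) (x t : ℝ) : ℝ :=
  pdt v x t - pdx (pdx v) x t - u x t * v x t + v x t

section
variable {a b χ : ℝ} {B1 B2 : ℝ → ℝ → ℝ} {u0 v0 : ℝ → ℝ} {u v : ℝ → ℝ → ℝ} {Tmax : ℝ≥0∞}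

lemma srcU_eq (h : CrimeSol a b χ B1 B2 u0 v0 u v Tmax) {x t : ℝ} (hx : x ∈ Ioo a b)
    (ht : t ∈ It' Tmax) : srcU χ u v x t = B1 x t := by
  have hx' := Ioo_subset_Icc_self hx
  have h1 := (h.u_reg x hx' t ht).1.hasDerivAt
  have h2 := (h.v_reg x hx' t ht).1.hasDerivAt
  have h3 := (h.v_reg x hx' t ht).2.1.hasDerivAt
  have hv := (h.v_pos x hx' t ht).ne'
  have h4 := ((h1.div h2 hv).mul h3).deriv
  have h5 : pdx (fun y s => u y s / v y s * pdx v y s) x t =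
      (pdx u x t * v x t - u x t * pdx v x t) / v x t ^ 2 * pdx v x t
        + u x t / v x t * pdx (pdx v) x t := h4
  have h6 := h.u_eq x hx t ht
  rw [h5] at h6
  unfold srcU
  rw [h6]
  field_simp
  ring

lemma srcV_eq (h : CrimeSol a b χ B1 B2 u0 v0 u v Tmax) {x t : ℝ} (hx : x ∈ Ioo a b)
    (ht : t ∈ It' Tmax) : srcV u v x t = B2 x t := by
  unfold srcV
  rw [h.v_eq x hx t ht]
  ring

lemma cont_parts {f g k : ℝ × ℝ → ℝ} {s : Set (ℝ × ℝ)}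
    (h : ContinuousOn (fun z => (f z, g z, k z)) s) :
    ContinuousOn f s ∧ ContinuousOn g s ∧ ContinuousOn k s :=
  ⟨h.fst, h.snd.fst, h.snd.snd⟩

lemma srcU_cont (h : CrimeSol a b χ B1 B2 u0 v0 u v Tmax) {t : ℝ}
    (ht : t ∈ It' Tmax) : ContinuousOn (fun x => srcU χ u v x t) (Icc a b) := by
  obtain ⟨p1, p2, p3⟩ := cont_parts h.u_cont21
  obtain ⟨q1, q2, q3⟩ := cont_parts h.v_cont21
  have h1 := Sys.slice (h := u) (h.u_cont.mono (prod_mono le_rfl (ItP_sub _))) ht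
  have h5 := Sys.slice (h := v) (h.v_cont.mono (prod_mono le_rfl (ItP_sub _))) ht
  have h2 := Sys.slice (h := pdx u) p1 ht
  have h3 := Sys.slice (h := pdx (pdx u)) p2 ht
  have h4 := Sys.slice (h := pdt u) p3 ht
  have h6 := Sys.slice (h := pdx v) q1 ht
  have h7 := Sys.slice (h := pdx (pdx v)) q2 ht
  have hv : ∀ x ∈ Icc a b, v x t ≠ 0 := fun x hx => (h.v_pos x hx t ht).ne'
  have hv2 : ∀ x ∈ Icc a b, v x t ^ 2 ≠ 0 := fun x hx => pow_ne_zero 2 (hv x hx)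
  unfold srcU
  exact ((h4.sub h3).add (continuousOn_const.mul ((((h2.mul h6).div h5 hv).add
    ((h1.mul h7).div h5 hv)).sub ((h1.mul (h6.pow 2)).div (h5.pow 2) hv2)))).add (h1.mul h5)

lemma srcV_cont (h : CrimeSol a b χ B1 B2 u0 v0 u v Tmax) {t : ℝ}
    (ht : t ∈ It' Tmax) : ContinuousOn (fun x => srcV u v x t) (Icc a b) := by
  obtain ⟨q1, q2, q3⟩ := cont_parts h.v_cont21
  have h1 := Sys.slice (h := u) (h.u_cont.mono (prod_mono le_rfl (ItP_sub _))) ht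
  have h5 := Sys.slice (h := v) (h.v_cont.mono (prod_mono le_rfl (ItP_sub _))) ht
  have h6 := Sys.slice (h := pdt v) q3 ht
  have h7 := Sys.slice (h := pdx (pdx v)) q2 ht
  unfold srcV
  exact ((h6.sub h7).sub (h1.mul h5)).add h5

/-- The abstract system attached to a solution. -/
def mkSys (hab : a < b) (h : CrimeSol a b χ B1 B2 u0 v0 u v Tmax) {M : ℝ}
    (hB1 : ∀ x t, B1 x t ∈ Icc 0 M) (hB2 : ∀ x t, B2 x t ∈ Icc 0 M) {Tm : ℝ≥0∞}
    (hTm : Tm ≤ Tmax) : Sys a b χ M (It' Tm) where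
  u := u
  ux := pdx u
  uxx := pdx (pdx u)
  ut := pdt u
  v := v
  vx := pdx v
  vxx := pdx (pdx v)
  vt := pdt v
  Ru := srcU χ u v
  Rv := srcV u v
  hab := hab
  hJ := ItP_open Tm
  hJc := ItP_conn Tm
  cu := h.u_cont.mono (prod_mono le_rfl ((ItP_mono hTm).trans (ItP_sub _)))
  cux := (cont_parts h.u_cont21).1.mono (prod_mono le_rfl (ItP_mono hTm))
  cuxx := (cont_parts h.u_cont21).2.1.mono (prod_mono le_rfl (ItP_mono hTm))
  cut := (cont_parts h.u_cont21).2.2.mono (prod_mono le_rfl (ItP_mono hTm))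
  cv := h.v_cont.mono (prod_mono le_rfl ((ItP_mono hTm).trans (ItP_sub _)))
  cvx := (cont_parts h.v_cont21).1.mono (prod_mono le_rfl (ItP_mono hTm))
  cvxx := (cont_parts h.v_cont21).2.1.mono (prod_mono le_rfl (ItP_mono hTm))
  cvt := (cont_parts h.v_cont21).2.2.mono (prod_mono le_rfl (ItP_mono hTm))
  du := fun x hx t ht => (h.u_reg x hx t (ItP_mono hTm ht)).1.hasDerivAt
  ddu := fun x hx t ht => (h.u_reg x hx t (ItP_mono hTm ht)).2.1.hasDerivAt
  dtu := fun x hx t ht => (h.u_reg x hx t (ItP_mono hTm ht)).2.2.hasDerivAt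
  dv := fun x hx t ht => (h.v_reg x hx t (ItP_mono hTm ht)).1.hasDerivAt
  ddv := fun x hx t ht => (h.v_reg x hx t (ItP_mono hTm ht)).2.1.hasDerivAt
  dtv := fun x hx t ht => (h.v_reg x hx t (ItP_mono hTm ht)).2.2.hasDerivAt
  upos := fun x hx t ht => h.u_pos x hx t (ItP_mono hTm ht)
  vpos := fun x hx t ht => h.v_pos x hx t (ItP_mono hTm ht)
  ubc := fun t ht => h.u_bc t (ItP_mono hTm ht)
  vbc := fun t ht => h.v_bc t (ItP_mono hTm ht)
  hRu := fun x t => rfl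
  hRv := fun x t => rfl
  Ru0 := fun x hx t ht => (ext_bd hab (srcU_cont h (ItP_mono hTm ht))
    (fun y hy => by rw [srcU_eq h hy (ItP_mono hTm ht)]; exact hB1 y t) x hx).1
  RuM := fun x hx t ht => (ext_bd hab (srcU_cont h (ItP_mono hTm ht))
    (fun y hy => by rw [srcU_eq h hy (ItP_mono hTm ht)]; exact hB1 y t) x hx).2
  Rv0 := fun x hx t ht => (ext_bd hab (srcV_cont h (ItP_mono hTm ht))
    (fun y hy => by rw [srcV_eq h hy (ItP_mono hTm ht)]; exact hB2 y t) x hx).1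
  RvM := fun x hx t ht => (ext_bd hab (srcV_cont h (ItP_mono hTm ht))
    (fun y hy => by rw [srcV_eq h hy (ItP_mono hTm ht)]; exact hB2 y t) x hx).2

lemma ioo_int (hab : a < b) (f : ℝ → ℝ) : ∫ x in Ioo a b, f x = ∫ x in a..b, f x := by
  rw [intervalIntegral.integral_of_le hab.le, integral_Ioc_eq_integral_Ioo]

/-- Bounds on an initial time interval. -/
lemma compact_bd (hab : a < b) (hv0 : ∀ x ∈ Icc a b, 0 < v0 x)
    (h : CrimeSol a b χ B1 B2 u0 v0 u v Tmax) {t0 : ℝ} (ht0 : t0 ∈ It' Tmax) :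
    ∃ c K, 0 < c ∧ 0 ≤ K ∧ ∀ t, 0 ≤ t → t ≤ t0 → ∀ x ∈ Icc a b,
      c ≤ v x t ∧ v x t ≤ K ∧ u x t ≤ K := by
  have hsub : Icc a b ×ˢ Icc 0 t0 ⊆ Icc a b ×ˢ It Tmax := by
    rintro ⟨x, t⟩ ⟨hx, ht⟩
    exact ⟨hx, ht.1, (ENNReal.ofReal_le_ofReal ht.2).trans_lt ht0.2⟩
  have hcpt : IsCompact (Icc a b ×ˢ Icc 0 t0) := isCompact_Icc.prod isCompact_Icc
  have hne : (Icc a b ×ˢ Icc 0 t0).Nonempty := ⟨(a, 0), ⟨⟨le_rfl, hab.le⟩, ⟨le_rfl, ht0.1.le⟩⟩⟩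
  have cu := h.u_cont.mono hsub
  have cv := h.v_cont.mono hsub
  obtain ⟨z, hz, hzm⟩ := hcpt.exists_isMinOn hne cv
  obtain ⟨z1, hz1, hz1m⟩ := hcpt.exists_isMaxOn hne cv
  obtain ⟨z2, hz2, hz2m⟩ := hcpt.exists_isMaxOn hne cu
  refine ⟨v z.1 z.2, max 0 (max (v z1.1 z1.2) (u z2.1 z2.2)), ?_, le_max_left _ _, ?_⟩
  · rcases hz.2.1.eq_or_lt with h0 | h0
    · rw [← h0, h.v_init _ hz.1]
      exact hv0 _ hz.1
    · exact h.v_pos _ hz.1 _ ⟨h0, (hsub hz).2.2⟩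
  · intro t h1 h2 x hx
    have hm : (x, t) ∈ Icc a b ×ˢ Icc 0 t0 := ⟨hx, h1, h2⟩
    exact ⟨hzm hm, (hz1m hm).trans ((le_max_left _ _).trans (le_max_right _ _)),
      (hz2m hm).trans ((le_max_right _ _).trans (le_max_right _ _))⟩

lemma tau_bd (T : ℝ≥0∞) : 0 ≤ tauOf T ∧ tauOf T ≤ 1 :=
  ⟨ENNReal.toReal_nonneg, by
    unfold tauOf
    exact ENNReal.toReal_le_of_le_ofReal zero_le_one (by simp)⟩

lemma final (hab : a < b) (hχ : 0 < χ) (hv0 : ∀ x ∈ Icc a b, 0 < v0 x)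
    (h : CrimeSol a b χ B1 B2 u0 v0 u v Tmax) {M : ℝ} (hM : 0 ≤ M)
    (hB1 : ∀ x t, B1 x t ∈ Icc 0 M) (hB2 : ∀ x t, B2 x t ∈ Icc 0 M) {Tm : ℝ≥0∞}
    (hTm : Tm ≤ Tmax) {p : ℝ} (hp : p ∈ Ioo (0 : ℝ) 1) (hpχ : p < 1 / χ ^ 2) {t0 : ℝ}
    (ht0 : t0 ∈ It' Tm)
    (hlow : ∃ d, 0 < d ∧ ∀ t ∈ It' Tm, t0 ≤ t → ∀ x ∈ Icc a b, d ≤ v x t) :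
    ∃ C : ℝ, 0 < C ∧ ∀ t : ℝ, 0 < t → ENNReal.ofReal (t + tauOf Tmax) < Tm →
      (∫ s in t..(t + tauOf Tmax), ∫ x in Set.Ioo a b, u x s ^ (p + 2)) ≤ C := by
  let S := mkSys hab h hB1 hB2 hTm
  obtain ⟨c, K0, hc, hK0, hcb⟩ := compact_bd hab hv0 h (ItP_mono hTm ht0)
  obtain ⟨d, hd, hdv⟩ := hlow
  have hdm : 0 < min c d := lt_min hc hd
  have hv : ∀ t ∈ It' Tm, ∀ x ∈ Icc a b, min c d ≤ S.v x t := by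
    intro t ht x hx
    rcases le_total t t0 with h1 | h1
    · exact (min_le_left _ _).trans (hcb t ht.1.le h1 x hx).1
    · exact (min_le_right _ _).trans (hdv t ht h1 x hx)
  obtain ⟨K1, hK1⟩ := S.mass hM hdm ht0 hv
  have hba : 0 ≤ b - a := by linarith
  have hKb : ∀ t ∈ It' Tm, S.E 1 0 t ≤ max (K0 * (b - a)) K1 ∧
      S.E 0 1 t ≤ max (K0 * (b - a)) K1 := by
    intro t ht
    rcases le_total t t0 with h1 | h1
    · have e : ∀ f : ℝ → ℝ, ContinuousOn f (Icc a b) → (∀ x ∈ Icc a b, f x ≤ K0) →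
          ∫ x in a..b, f x ≤ K0 * (b - a) := by
        intro f hf hfK
        have := intervalIntegral.integral_mono_on hab.le (Sys.ii hab hf)
          (intervalIntegrable_const (c := K0)) hfK
        simpa [mul_comm] using this
      constructor
      · refine (e _ (S.cont_uv 1 0 ht) ?_).trans (le_max_left _ _)
        intro x hx
        have hh : S.u x t ≤ K0 := (hcb t ht.1.le h1 x hx).2.2
        simpa using hh
      · refine (e _ (S.cont_uv 0 1 ht) ?_).trans (le_max_left _ _)
        intro x hx
        have hh : S.v x t ≤ K0 := (hcb t ht.1.le h1 x hx).2.1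
        simpa using hh
    · exact ⟨(hK1 t ht h1).1.trans (le_max_right _ _), (hK1 t ht h1).2.trans (le_max_right _ _)⟩
  have hpx : p * χ ^ 2 < 1 := by
    rwa [lt_div_iff₀ (by positivity)] at hpχ
  obtain ⟨C, hC, hmain⟩ := S.main hχ hM hdm hp.1 hp.2 hpx
    (le_max_of_le_left (mul_nonneg hK0 hba)) hv (fun t ht => (hKb t ht).1)
    (fun t ht => (hKb t ht).2)
  refine ⟨C, hC, fun t ht htt => ?_⟩
  obtain ⟨hτ0, hτ1⟩ := tau_bd Tmax
  have m2 : t + tauOf Tmax ∈ It' Tm := ⟨by linarith, htt⟩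
  have m1 : t ∈ It' Tm := ⟨ht, (ENNReal.ofReal_le_ofReal (by linarith)).trans_lt htt⟩
  have := hmain t m1 _ m2 (by linarith) (by linarith)
  simp_rw [Sys.E_u] at this
  simp_rw [ioo_int hab]
  exact this

end
end

/-- Lemma 4.1 (spatio-temporal bound on `∫∫ u^{p+2}`). -/
theorem space_time_bound_for_u
    (a b χ : ℝ) (hab : a < b) (hχ : 0 < χ)
    (B1 B2 : ℝ → ℝ → ℝ) (hB1 : HypB a b B1) (hB2 : HypB a b B2)
    (u0 v0 : ℝ → ℝ) (hinit : HypInit a b u0 v0)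
    (Tmax : ℝ≥0∞) (hT : 0 < Tmax)
    (u v : ℝ → ℝ → ℝ) (hsol : CrimeSol a b χ B1 B2 u0 v0 u v Tmax)
    (p : ℝ) (hp : p ∈ Set.Ioo (0:ℝ) 1) (hpχ : p < 1 / χ^2) :
    (∀ T : ℝ, 0 < T → ∃ C : ℝ, 0 < C ∧
      ∀ t : ℝ, 0 < t →
        ENNReal.ofReal (t + tauOf Tmax) < min (ENNReal.ofReal T) Tmax →
        (∫ s in t..(t + tauOf Tmax), ∫ x in Set.Ioo a b, u x s ^ (p + 2)) ≤ C) ∧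
    (HypH2 a b B2 → ∃ C : ℝ, 0 < C ∧
      ∀ t : ℝ, 0 < t → ENNReal.ofReal (t + tauOf Tmax) < Tmax →
        (∫ s in t..(t + tauOf Tmax), ∫ x in Set.Ioo a b, u x s ^ (p + 2)) ≤ C) := by
  obtain ⟨h10, ⟨M1, hM1⟩, -⟩ := hB1
  obtain ⟨h20, ⟨M2, hM2⟩, -⟩ := hB2
  have hM : 0 ≤ max M1 M2 := le_max_of_le_left ((h10 0 0).trans (hM1 0 0))
  have k1 : ∀ x t, B1 x t ∈ Icc 0 (max M1 M2) :=
    fun x t => ⟨h10 x t, (hM1 x t).trans (le_max_left _ _)⟩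
  have k2 : ∀ x t, B2 x t ∈ Icc 0 (max M1 M2) :=
    fun x t => ⟨h20 x t, (hM2 x t).trans (le_max_right _ _)⟩
  have hv0 := hinit.2.2.2
  constructor
  · intro T hTpos
    have hTm : min (ENNReal.ofReal T) Tmax ≤ Tmax := min_le_right _ _
    obtain ⟨t0, ht0⟩ := ItP_ne (T := min (ENNReal.ofReal T) Tmax)
      (lt_min (ENNReal.ofReal_pos.2 hTpos) hT)
    refine final hab hχ hv0 hsol hM k1 k2 hTm hp hpχ ht0 ?_
    obtain ⟨c, K0, hc, hK0, hcb⟩ := compact_bd hab hv0 hsol (ItP_mono hTm ht0)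
    refine ⟨c * exp (-T), by positivity, fun t ht htt x hx => ?_⟩
    have h1 := (mkSys hab hsol k1 k2 hTm).comparison ht0 ht htt hc
      (fun y hy => (hcb t0 ht0.1.le le_rfl y hy).1) x hx
    refine le_trans ?_ h1
    have h2 : t < T := by
      have := ht.2.trans_le (min_le_left _ _)
      exact (ENNReal.ofReal_lt_ofReal_iff hTpos).1 this
    have h3 := ht0.1
    gcongr
    linarith
  · rintro ⟨c, hc, hcB⟩
    obtain ⟨t0, ht0⟩ := ItP_ne hT
    refine final hab hχ hv0 hsol hM k1 k2 le_rfl hp hpχ ht0 ?_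
    refine (mkSys hab hsol k1 k2 le_rfl).lower_H2 hc ht0 fun t ht => ?_
    refine (hcB t ht.1).trans (le_of_eq ?_)
    rw [← ioo_int hab]
    exact setIntegral_congr_fun measurableSet_Ioo (fun x hx => (srcV_eq hsol hx ht).symm)
end
end

section
/- Let χ > 0, assume (B) and (init), and let (u, v) be the maximal classical solution of the crime model on Ω̄ × [0, T_max). Let r ∈ (1, 3/2) satisfy r < 1 + 1/(2χ²). Then for all T > 0 there exists C(T) > 0 such that, with T̂_max := min{T, T_max}, ‖v_x(·,t)‖_{L^r(Ω)} ≤ C(T) for all t ∈ (0, T̂_max), and sup_{T>0} C(T) < ∞ if hypothesis (H2) holds. -/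
open Real MeasureTheory Filter Topology Set
open scoped ENNReal NNReal

noncomputable section

/-- Parseval's identity for sine series on `[0, L]`. -/
lemma aux_parseval (L : ℝ) (hL : 0 < L) (h : ℝ → ℝ) (hc : ContinuousOn h (Icc 0 L))
    (h0 : h 0 = 0) :
    HasSum (fun n : ℤ => (∫ y in (0:ℝ)..L, h y * Real.sin (n * π / L * y)) ^ 2 / L ^ 2)
      (1 / L * ∫ y in (0:ℝ)..L, h y ^ 2) := by
  have hLL : -L < L := by linarith
  set H : ℝ → ℝ := fun y => h (max y 0) - h (max (-y) 0) with hH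
  have Hpos : ∀ y, 0 ≤ y → H y = h y := by
    intro y hy
    simp only [hH]
    rw [max_eq_left hy, max_eq_right (by linarith), h0, sub_zero]
  have Hneg : ∀ y, H (-y) = - H y := by
    intro y
    simp only [hH, neg_neg]; ring
  have Hc : ContinuousOn H (Icc (-L) L) := by
    apply ContinuousOn.sub
    · refine hc.comp (by fun_prop) ?_
      intro y hy
      exact ⟨le_max_right _ _, max_le hy.2 hL.le⟩
    · refine hc.comp (by fun_prop) ?_
      intro y hy
      exact ⟨le_max_right _ _, max_le (by linarith [hy.1]) hL.le⟩
  have hmem : MemLp (fun y => (H y : ℂ)) 2 (volume.restrict (Ioc (-L) L)) := by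
    have hcc : ContinuousOn (fun y => (H y : ℂ)) (Icc (-L) L) :=
      Complex.continuous_ofReal.comp_continuousOn Hc
    obtain ⟨M, hM⟩ := isCompact_Icc.exists_bound_of_continuousOn hcc
    refine MemLp.of_bound ?_ M ?_
    · exact (hcc.mono Ioc_subset_Icc_self).aestronglyMeasurable measurableSet_Ioc
    · filter_upwards [ae_restrict_mem measurableSet_Ioc] with y hy
      exact hM y (Ioc_subset_Icc_self hy)
  have key := hasSum_sq_fourierCoeffOn hLL hmem
  -- splitting
  have split : ∀ (G : ℝ → ℂ), ContinuousOn G (Icc (-L) L) →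
      ∫ y in (-L)..L, G y = ∫ y in (0:ℝ)..L, (G y + G (-y)) := by
    intro G hG
    have i1 : IntervalIntegrable G volume (-L) 0 :=
      (hG.mono (by rw [uIcc_of_le (by linarith)]; exact Icc_subset_Icc le_rfl hL.le)).intervalIntegrable
    have i2 : IntervalIntegrable G volume 0 L :=
      (hG.mono (by rw [uIcc_of_le hL.le]; exact Icc_subset_Icc (by linarith) le_rfl)).intervalIntegrable
    have i3 : IntervalIntegrable (fun y => G (-y)) volume 0 L := by
      refine ContinuousOn.intervalIntegrable ?_
      refine hG.comp (by fun_prop) ?_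
      rw [uIcc_of_le hL.le]
      intro y hy
      exact ⟨by linarith [hy.2], by linarith [hy.1]⟩
    rw [← intervalIntegral.integral_add_adjacent_intervals i1 i2,
      intervalIntegral.integral_add i2 i3, intervalIntegral.integral_comp_neg]
    simp [add_comm]
  convert key using 1
  · funext n
    rw [fourierCoeffOn_eq_integral]
    have e1 : ∫ x in (-L)..L, (fourier (-n) (x : AddCircle (L - -L))) • ((H x : ℝ) : ℂ)
        = ∫ x in (-L)..L, Complex.exp (-((n * π / L * x : ℝ) : ℂ) * Complex.I) * ((H x : ℝ) : ℂ) := by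
      congr 1
      funext x
      rw [fourier_coe_apply, smul_eq_mul]
      congr 2
      push_cast
      have : (L : ℂ) ≠ 0 := by exact_mod_cast hL.ne'
      field_simp
      ring
    rw [e1, split]
    · have e2 : ∫ y in (0:ℝ)..L, (Complex.exp (-((n * π / L * y : ℝ) : ℂ) * Complex.I) * ((H y : ℝ) : ℂ)
          + Complex.exp (-((n * π / L * (-y) : ℝ) : ℂ) * Complex.I) * ((H (-y) : ℝ) : ℂ))
          = (-2 * Complex.I) * ((∫ y in (0:ℝ)..L, h y * Real.sin (n * π / L * y) : ℝ) : ℂ) := by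
        rw [← intervalIntegral.integral_ofReal, ← intervalIntegral.integral_const_mul]
        refine intervalIntegral.integral_congr ?_
        rw [uIcc_of_le hL.le]
        intro y hy
        simp only
        rw [Hneg, Hpos y hy.1]
        push_cast
        rw [Complex.sin]
        have : Complex.I * Complex.I = -1 := Complex.I_mul_I
        have e3 : -((n:ℂ) * π / L * -y) * Complex.I = (n:ℂ) * π / L * y * Complex.I := by ring
        have e4 : -((n:ℂ) * π / L * y) * Complex.I = -((n:ℂ) * π / L * y) * Complex.I := by ring
        rw [e3]
        linear_combination (-(h y) * (Complex.exp (-((n:ℂ) * π / L * y) * Complex.I) - Complex.exp ((n:ℂ) * π / L * y * Complex.I)) ) * (-this)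
      rw [e2, norm_smul, norm_mul, Complex.norm_real]
      simp only [norm_mul, norm_neg, Complex.norm_I, Complex.norm_ofNat, Real.norm_eq_abs]
      rw [mul_pow, mul_pow, sq_abs, sq_abs]
      have : L ≠ 0 := hL.ne'
      field_simp
      ring
    · refine ContinuousOn.mul (by fun_prop) (Complex.continuous_ofReal.comp_continuousOn Hc)
  · have : ∫ x in (-L)..L, ‖((H x : ℝ) : ℂ)‖ ^ 2 = 2 * ∫ y in (0:ℝ)..L, h y ^ 2 := by
      have := split (fun y => (((H y) ^ 2 : ℝ) : ℂ)) (Complex.continuous_ofReal.comp_continuousOn (Hc.pow 2))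
      rw [intervalIntegral.integral_ofReal] at this
      have e5 : ∫ y in (0:ℝ)..L, ((((H y) ^ 2 : ℝ) : ℂ) + (((H (-y)) ^ 2 : ℝ) : ℂ))
          = ((2 * ∫ y in (0:ℝ)..L, h y ^ 2 : ℝ) : ℂ) := by
        rw [← intervalIntegral.integral_const_mul, ← intervalIntegral.integral_ofReal]
        refine intervalIntegral.integral_congr ?_
        rw [uIcc_of_le hL.le]
        intro y hy
        simp only
        rw [Hneg, Hpos y hy.1]
        push_cast; ring
      rw [e5] at this
      have := Complex.ofReal_injective this
      rw [← this]
      congr 1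
      funext x
      rw [Complex.norm_real, Real.norm_eq_abs, sq_abs]
    rw [this, smul_eq_mul]
    have : L ≠ 0 := hL.ne'
    field_simp
    ring

/-- A Gronwall type inequality. -/
lemma aux_gronwall (y y' : ℝ → ℝ) (δ C t0 t1 : ℝ) (hδ : 0 < δ) (hC : 0 ≤ C) (h01 : t0 ≤ t1)
    (hd : ∀ t ∈ Icc t0 t1, HasDerivAt y (y' t) t)
    (hle : ∀ t ∈ Icc t0 t1, y' t ≤ C - δ * y t) :
    y t1 ≤ |y t0| + C / δ := by
  set g : ℝ → ℝ := fun t => Real.exp (δ * t) * (y t - C / δ) with hg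
  have hgd : ∀ t ∈ Icc t0 t1, HasDerivAt g
      (Real.exp (δ * t) * δ * (y t - C / δ) + Real.exp (δ * t) * y' t) t := by
    intro t ht
    have h1 : HasDerivAt (fun t => Real.exp (δ * t)) (Real.exp (δ * t) * δ) t := by
      have := ((hasDerivAt_id t).const_mul δ).exp
      simpa using this
    exact h1.mul ((hd t ht).sub_const _)
  have hanti : AntitoneOn g (Icc t0 t1) := by
    refine antitoneOn_of_deriv_nonpos (convex_Icc _ _)
      (fun t ht => (hgd t ht).continuousAt.continuousWithinAt)
      (fun t ht => (hgd t (interior_subset ht)).differentiableAt.differentiableWithinAt) ?_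
    intro t ht
    have ht' := interior_subset ht
    rw [(hgd t ht').deriv]
    have := hle t ht'
    have e : Real.exp (δ * t) * δ * (y t - C / δ) + Real.exp (δ * t) * y' t
        = Real.exp (δ * t) * (y' t - (C - δ * y t)) := by field_simp; ring
    rw [e]
    exact mul_nonpos_of_nonneg_of_nonpos (Real.exp_pos _).le (by linarith)
  have h := hanti (left_mem_Icc.2 h01) (right_mem_Icc.2 h01) h01
  simp only [hg] at h
  have hCd : 0 ≤ C / δ := by positivity
  by_contra hcon
  push Not at hcon
  have h2 : |y t0| < y t1 - C / δ := by linarith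
  have h3 : y t0 - C / δ ≤ |y t0| := by linarith [le_abs_self (y t0)]
  have h4 : Real.exp (δ * t0) ≤ Real.exp (δ * t1) :=
    Real.exp_le_exp.2 (mul_le_mul_of_nonneg_left h01 hδ.le)
  have h5 : Real.exp (δ * t0) * (y t0 - C / δ) ≤ Real.exp (δ * t0) * |y t0| :=
    mul_le_mul_of_nonneg_left h3 (Real.exp_pos _).le
  have h6 : Real.exp (δ * t0) * |y t0| ≤ Real.exp (δ * t1) * |y t0| :=
    mul_le_mul_of_nonneg_right h4 (abs_nonneg _)
  have h7 : Real.exp (δ * t1) * |y t0| < Real.exp (δ * t1) * (y t1 - C / δ) :=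
    mul_lt_mul_of_pos_left h2 (Real.exp_pos _)
  linarith

/-- Differentiation under the integral sign. -/
lemma aux_deriv_integral (a b : ℝ) (hab : a < b) (J : Set ℝ) (hJ : IsOpen J)
    (g g' : ℝ → ℝ → ℝ)
    (hg : ∀ t ∈ J, ContinuousOn (fun x => g x t) (Icc a b))
    (hg' : ContinuousOn (fun p : ℝ × ℝ => g' p.1 p.2) (Icc a b ×ˢ J))
    (hd : ∀ x ∈ Icc a b, ∀ t ∈ J, HasDerivAt (fun s => g x s) (g' x t) t)
    (t : ℝ) (ht : t ∈ J) :
    HasDerivAt (fun s => ∫ x in a..b, g x s) (∫ x in a..b, g' x t) t := by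
  obtain ⟨ε, hε, hball⟩ := Metric.nhds_basis_closedBall.mem_iff.1 (hJ.mem_nhds ht)
  have hKc : IsCompact (Icc a b ×ˢ Metric.closedBall t ε) :=
    isCompact_Icc.prod (isCompact_closedBall t ε)
  obtain ⟨M, hM⟩ := hKc.exists_bound_of_continuousOn
    (hg'.mono (Set.prod_mono_right hball))
  have huI : uIoc a b = Ioc a b := uIoc_of_le hab.le
  refine (intervalIntegral.hasDerivAt_integral_of_dominated_loc_of_deriv_le
    (F := fun s x => g x s) (F' := fun s x => g' x s) (bound := fun _ => M)
    (Metric.closedBall_mem_nhds t hε) ?_ ?_ ?_ ?_ ?_ ?_).2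
  · filter_upwards [hJ.mem_nhds ht] with s hs
    rw [huI]
    exact ((hg s hs).mono Ioc_subset_Icc_self).aestronglyMeasurable measurableSet_Ioc
  · exact ContinuousOn.intervalIntegrable (by rw [uIcc_of_le hab.le]; exact hg t ht)
  · rw [huI]
    refine ContinuousOn.aestronglyMeasurable ?_ measurableSet_Ioc
    refine hg'.comp (f := fun x => (x, t)) (by fun_prop) ?_
    intro x hx
    exact ⟨Ioc_subset_Icc_self hx, ht⟩
  · refine Eventually.of_forall fun x hx s hs => ?_
    rw [huI] at hx
    exact hM (x, s) ⟨Ioc_subset_Icc_self hx, hs⟩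
  · exact intervalIntegrable_const
  · refine Eventually.of_forall fun x hx s hs => ?_
    rw [huI] at hx
    exact hd x (Ioc_subset_Icc_self hx) s (hball hs)

/-- Interpolation bound of the sup norm. -/
lemma aux_sup_bound (a b : ℝ) (w w' : ℝ → ℝ)
    (hw : ∀ x ∈ Icc a b, HasDerivAt w (w' x) x) (hw' : ContinuousOn w' (Icc a b))
    (hpos : ∀ x ∈ Icc a b, 0 ≤ w x)
    (l : ℝ) (hl : 0 < l) (hl2 : l ≤ (b - a) / 2) (x : ℝ) (hx : x ∈ Icc a b) (θ : ℝ) (hθ : 0 < θ) :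
    w x ≤ (∫ y in a..b, w y) / l + θ * l + (∫ y in a..b, w' y ^ 2) / θ := by
  -- a window `[c, c + l]` inside `[a, b]` containing `x`
  obtain ⟨c, hca, hcb, hxc⟩ : ∃ c, a ≤ c ∧ c + l ≤ b ∧ x ∈ Icc c (c + l) := by
    by_cases h : x + l ≤ b
    · exact ⟨x, hx.1, h, le_rfl, by linarith⟩
    · push Not at h
      exact ⟨x - l, by linarith, by linarith [hx.2], by linarith, by linarith⟩
  have hsub : Icc c (c + l) ⊆ Icc a b := Icc_subset_Icc hca hcb
  have hwc : ContinuousOn w (Icc a b) := fun y hy => (hw y hy).continuousAt.continuousWithinAt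
  have hab : a ≤ b := hx.1.trans hx.2
  have hcl : c ≤ c + l := by linarith
  -- a minimum point
  obtain ⟨z, hz, hzmin⟩ := isCompact_Icc.exists_isMinOn (nonempty_Icc.2 hcl) (hwc.mono hsub)
  have iw : IntervalIntegrable w volume a b :=
    ContinuousOn.intervalIntegrable (by rwa [uIcc_of_le hab])
  have iw2 : IntervalIntegrable (fun y => w' y ^ 2) volume a b :=
    ContinuousOn.intervalIntegrable (by rw [uIcc_of_le hab]; exact hw'.pow 2)
  have iwl : IntervalIntegrable w volume c (c + l) :=
    ContinuousOn.intervalIntegrable (by rw [uIcc_of_le hcl]; exact hwc.mono hsub)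
  have iw2l : IntervalIntegrable (fun y => w' y ^ 2) volume c (c + l) :=
    ContinuousOn.intervalIntegrable (by rw [uIcc_of_le hcl]; exact (hw'.pow 2).mono hsub)
  have h1 : w z * l ≤ ∫ y in a..b, w y := by
    have h11 : ∫ y in c..(c + l), w z ≤ ∫ y in c..(c + l), w y :=
      intervalIntegral.integral_mono_on hcl intervalIntegrable_const iwl (fun y hy => hzmin hy)
    have h12 : ∫ y in c..(c + l), w y ≤ ∫ y in a..b, w y := by
      refine intervalIntegral.integral_mono_interval hca hcl hcb ?_ iw
      filter_upwards [ae_restrict_mem measurableSet_Ioc] with y hy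
      exact hpos y (Ioc_subset_Icc_self hy)
    simp at h11
    linarith
  have h2 : |w x - w z| ≤ θ * l + (∫ y in a..b, w' y ^ 2) / θ := by
    have hxz : uIcc z x ⊆ Icc c (c + l) := uIcc_subset_Icc hz hxc
    have e : ∫ y in z..x, w' y = w x - w z :=
      intervalIntegral.integral_eq_sub_of_hasDerivAt (fun y hy => hw y (hsub (hxz hy)))
        ((hw'.mono (hxz.trans hsub)).intervalIntegrable)
    rw [← e]
    have hIsub : uIoc z x ⊆ Ioc c (c + l) := by
      intro y hy
      rw [uIoc, mem_Ioc] at hy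
      exact ⟨lt_of_le_of_lt (le_min hz.1 hxc.1) hy.1, hy.2.trans (max_le hz.2 hxc.2)⟩
    have iabs : IntegrableOn (fun y => ‖w' y‖) (Ioc c (c + l)) :=
      ((hw'.mono hsub).norm.integrableOn_Icc).mono_set Ioc_subset_Icc_self
    calc |∫ y in z..x, w' y| ≤ ∫ y in uIoc z x, ‖w' y‖ := by
          rw [← Real.norm_eq_abs]; exact intervalIntegral.norm_integral_le_integral_norm_uIoc
      _ ≤ ∫ y in Ioc c (c + l), ‖w' y‖ := by
          refine setIntegral_mono_set iabs ?_ (Eventually.of_forall hIsub)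
          exact Eventually.of_forall fun y => norm_nonneg _
      _ = ∫ y in c..(c + l), |w' y| := by
          rw [intervalIntegral.integral_of_le hcl]; rfl
      _ ≤ ∫ y in c..(c + l), (θ + w' y ^ 2 / θ) := by
          refine intervalIntegral.integral_mono_on hcl ?_ ?_ ?_
          · exact ContinuousOn.intervalIntegrable (by rw [uIcc_of_le hcl]; exact (hw'.mono hsub).abs)
          · exact intervalIntegrable_const.add (iw2l.div_const _)
          · intro y _
            have : 0 ≤ (|w' y| - θ) ^ 2 := sq_nonneg _
            have h3 : |w' y| ^ 2 = w' y ^ 2 := sq_abs _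
            rw [← h3, ← sub_nonneg]
            have : θ + |w' y| ^ 2 / θ - |w' y| = ((|w' y| - θ) ^ 2 + θ * |w' y|) / θ := by
              field_simp; ring
            rw [this]; positivity
      _ = θ * l + (∫ y in c..(c + l), w' y ^ 2) / θ := by
          rw [intervalIntegral.integral_add intervalIntegrable_const (iw2l.div_const _),
            intervalIntegral.integral_div]
          simp; ring
      _ ≤ θ * l + (∫ y in a..b, w' y ^ 2) / θ := by
          have : ∫ y in c..(c + l), w' y ^ 2 ≤ ∫ y in a..b, w' y ^ 2 :=
            intervalIntegral.integral_mono_interval hca hcl hcb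
              (Eventually.of_forall fun y => sq_nonneg _) iw2
          gcongr
  have h3 : w z ≤ (∫ y in a..b, w y) / l := by rw [le_div_iff₀ hl]; exact h1
  linarith [le_abs_self (w x - w z)]

lemma aux_It'_open (Tmax : ℝ≥0∞) : IsOpen (It' Tmax) := by
  have : It' Tmax = Ioi 0 ∩ ENNReal.ofReal ⁻¹' (Iio Tmax) := by
    ext t; simp [It']
  rw [this]
  exact isOpen_Ioi.inter (isOpen_Iio.preimage ENNReal.continuous_ofReal)

lemma aux_It'_mono {Tmax : ℝ≥0∞} {t0 t1 t : ℝ} (h0 : t0 ∈ It' Tmax) (h1 : t1 ∈ It' Tmax)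
    (ht : t ∈ Icc t0 t1) : t ∈ It' Tmax :=
  ⟨lt_of_lt_of_le h0.1 ht.1, lt_of_le_of_lt (ENNReal.ofReal_le_ofReal ht.2) h1.2⟩

lemma aux_section {a b : ℝ} {S : Set ℝ} {F : ℝ → ℝ → ℝ}
    (h : ContinuousOn (fun p : ℝ × ℝ => F p.1 p.2) (Icc a b ×ˢ S)) {t : ℝ} (ht : t ∈ S) :
    ContinuousOn (fun x => F x t) (Icc a b) :=
  h.comp (f := fun x => (x, t)) (by fun_prop) (fun _ hx => ⟨hx, ht⟩)

lemma aux_ii {a b : ℝ} (hab : a < b) {f : ℝ → ℝ} (h : ContinuousOn f (Icc a b)) :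
    IntervalIntegrable f volume a b :=
  ContinuousOn.intervalIntegrable (by rwa [uIcc_of_le hab.le])

lemma aux_div {a b : ℝ} {f g : ℝ → ℝ} (hf : ContinuousOn f (Icc a b))
    (hg : ContinuousOn g (Icc a b)) (h : ∀ x ∈ Icc a b, g x ≠ 0) :
    ContinuousOn (fun x => f x / g x) (Icc a b) := hf.div hg h

lemma aux_mono {a b : ℝ} (hab : a < b) {f g : ℝ → ℝ} (hf : ContinuousOn f (Icc a b))
    (hg : ContinuousOn g (Icc a b)) (h : ∀ x ∈ Ioo a b, f x ≤ g x) :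
    ∫ x in a..b, f x ≤ ∫ x in a..b, g x :=
  intervalIntegral.integral_mono_on_of_le_Ioo hab.le (aux_ii hab hf) (aux_ii hab hg) h

/-- The collection of facts about the solution at a positive time that we use. -/
structure AuxFacts (a b χ : ℝ) (B1 B2 : ℝ → ℝ → ℝ) (u v : ℝ → ℝ → ℝ) (t : ℝ) : Prop where
  cu : ContinuousOn (fun x => u x t) (Icc a b)
  cv : ContinuousOn (fun x => v x t) (Icc a b)
  cut : ContinuousOn (fun x => pdt u x t) (Icc a b)
  cvx : ContinuousOn (fun x => pdx v x t) (Icc a b)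
  cvxx : ContinuousOn (fun x => pdx (pdx v) x t) (Icc a b)
  cvt : ContinuousOn (fun x => pdt v x t) (Icc a b)
  upos : ∀ x ∈ Icc a b, 0 < u x t
  vpos : ∀ x ∈ Icc a b, 0 < v x t
  dux : ∀ x ∈ Icc a b, HasDerivAt (fun y => u y t) (pdx u x t) x
  duxx : ∀ x ∈ Icc a b, HasDerivAt (fun y => pdx u y t) (pdx (pdx u) x t) x
  dvx : ∀ x ∈ Icc a b, HasDerivAt (fun y => v y t) (pdx v x t) x
  dvxx : ∀ x ∈ Icc a b, HasDerivAt (fun y => pdx v y t) (pdx (pdx v) x t) x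
  ueq : ∀ x ∈ Ioo a b, pdt u x t = pdx (pdx u) x t
      - χ * pdx (fun y s => u y s / v y s * pdx v y s) x t
      - u x t * v x t + B1 x t
  veq : ∀ x ∈ Ioo a b, pdt v x t = pdx (pdx v) x t + u x t * v x t - v x t + B2 x t
  ua : pdx u a t = 0
  ub : pdx u b t = 0
  va : pdx v a t = 0
  vb : pdx v b t = 0

lemma aux_facts {a b χ : ℝ} {B1 B2 : ℝ → ℝ → ℝ} {u0 v0 : ℝ → ℝ} {u v : ℝ → ℝ → ℝ}
    {Tmax : ℝ≥0∞} (hsol : CrimeSol a b χ B1 B2 u0 v0 u v Tmax) {t : ℝ} (ht : t ∈ It' Tmax) :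
    AuxFacts a b χ B1 B2 u v t where
  cu := aux_section hsol.u_cont (⟨ht.1.le, ht.2⟩ : t ∈ It Tmax)
  cv := aux_section hsol.v_cont (⟨ht.1.le, ht.2⟩ : t ∈ It Tmax)
  cut := aux_section (F := pdt u) hsol.u_cont21.snd.snd ht
  cvx := aux_section (F := pdx v) hsol.v_cont21.fst ht
  cvxx := aux_section (F := pdx (pdx v)) hsol.v_cont21.snd.fst ht
  cvt := aux_section (F := pdt v) hsol.v_cont21.snd.snd ht
  upos := fun x hx => hsol.u_pos x hx t ht
  vpos := fun x hx => hsol.v_pos x hx t ht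
  dux := fun x hx => (hsol.u_reg x hx t ht).1.hasDerivAt
  duxx := fun x hx => (hsol.u_reg x hx t ht).2.1.hasDerivAt
  dvx := fun x hx => (hsol.v_reg x hx t ht).1.hasDerivAt
  dvxx := fun x hx => (hsol.v_reg x hx t ht).2.1.hasDerivAt
  ueq := fun x hx => hsol.u_eq x hx t ht
  veq := fun x hx => hsol.v_eq x hx t ht
  ua := (hsol.u_bc t ht).1
  ub := (hsol.u_bc t ht).2
  va := (hsol.v_bc t ht).1
  vb := (hsol.v_bc t ht).2

/-- Mass balance for `u`. -/
lemma aux_mass_u {a b χ : ℝ} (hab : a < b) {B1 B2 : ℝ → ℝ → ℝ} {u v : ℝ → ℝ → ℝ} {t : ℝ}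
    (H : AuxFacts a b χ B1 B2 u v t) (M1 : ℝ) (hM1 : ∀ x t, B1 x t ≤ M1) :
    ∫ x in a..b, pdt u x t ≤ M1 * (b - a) - ∫ x in a..b, u x t * v x t := by
  set J : ℝ → ℝ := fun y => pdx u y t - χ * (u y t / v y t * pdx v y t) with hJ
  have hq : ∀ x ∈ Icc a b, DifferentiableAt ℝ (fun y => u y t / v y t * pdx v y t) x := by
    intro x hx
    exact (((H.dux x hx).div (H.dvx x hx) (H.vpos x hx).ne').mul (H.dvxx x hx)).differentiableAt
  have hJd : ∀ x ∈ Icc a b, HasDerivAt J (pdx (pdx u) x t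
      - χ * pdx (fun y s => u y s / v y s * pdx v y s) x t) x := by
    intro x hx
    exact (H.duxx x hx).sub ((hq x hx).hasDerivAt.const_mul χ)
  have cφ : ContinuousOn (fun x => pdt u x t + u x t * v x t - M1) (Icc a b) :=
    (H.cut.add (H.cu.fun_mul H.cv)).sub continuousOn_const
  have h1 := intervalIntegral.integral_le_sub_of_hasDeriv_right_of_le hab.le
    (fun x hx => (hJd x hx).continuousAt.continuousWithinAt)
    (fun x hx => (hJd x (Ioo_subset_Icc_self hx)).hasDerivWithinAt)
    (φ := fun x => pdt u x t + u x t * v x t - M1) cφ.integrableOn_Icc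
    (by
      intro x hx
      have := H.ueq x hx
      have := hM1 x t
      linarith)
  have hJa : J a = 0 := by simp [hJ, H.ua, H.va]
  have hJb : J b = 0 := by simp [hJ, H.ub, H.vb]
  rw [hJa, hJb, intervalIntegral.integral_sub
    ((aux_ii hab H.cut).add (aux_ii hab (H.cu.fun_mul H.cv))) intervalIntegrable_const,
    intervalIntegral.integral_add (aux_ii hab H.cut) (aux_ii hab (H.cu.fun_mul H.cv))] at h1
  simp at h1
  linarith

lemma aux_vxx_zero {a b χ : ℝ} (hab : a < b) {B1 B2 : ℝ → ℝ → ℝ} {u v : ℝ → ℝ → ℝ} {t : ℝ}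
    (H : AuxFacts a b χ B1 B2 u v t) :
    ∫ x in a..b, pdx (pdx v) x t = 0 := by
  rw [intervalIntegral.integral_eq_sub_of_hasDerivAt
    (f := fun y => pdx v y t) (by rw [uIcc_of_le hab.le]; exact H.dvxx) (aux_ii hab H.cvxx)]
  simp [H.va, H.vb]

/-- Mass balance for `v`. -/
lemma aux_mass_v {a b χ : ℝ} (hab : a < b) {B1 B2 : ℝ → ℝ → ℝ} {u v : ℝ → ℝ → ℝ} {t : ℝ}
    (H : AuxFacts a b χ B1 B2 u v t) (M2 : ℝ) (hM2 : ∀ x t, B2 x t ≤ M2) :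
    ∫ x in a..b, pdt v x t ≤
      M2 * (b - a) + (∫ x in a..b, u x t * v x t) - ∫ x in a..b, v x t := by
  have h1 : ∫ x in a..b, pdt v x t ≤
      ∫ x in a..b, (pdx (pdx v) x t + u x t * v x t - v x t + M2) := by
    refine aux_mono hab H.cvt
      (((H.cvxx.add (H.cu.fun_mul H.cv)).sub H.cv).add continuousOn_const) ?_
    intro x hx
    have := H.veq x hx
    have := hM2 x t
    linarith
  have i1 := aux_ii hab H.cvxx
  have i2 := aux_ii hab (H.cu.fun_mul H.cv)
  have i3 := aux_ii hab H.cv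
  rw [intervalIntegral.integral_add ((i1.add i2).sub i3) intervalIntegrable_const,
    intervalIntegral.integral_sub (i1.add i2) i3, intervalIntegral.integral_add i1 i2,
    aux_vxx_zero hab H] at h1
  simp at h1
  linarith

/-- Bound for the source. -/
lemma aux_source {a b χ : ℝ} (hab : a < b) {B1 B2 : ℝ → ℝ → ℝ} {u v : ℝ → ℝ → ℝ} {t : ℝ}
    (H : AuxFacts a b χ B1 B2 u v t) (M2 : ℝ) (hM2 : ∀ x t, B2 x t ≤ M2)
    (hB2 : ∀ x t, 0 ≤ B2 x t) (K S : ℝ) (hS0 : 0 ≤ S) (hS : ∀ x ∈ Icc a b, v x t ≤ S)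
    (hK : ∫ x in a..b, u x t ≤ K) :
    ∫ x in a..b, |pdt v x t - pdx (pdx v) x t + v x t| ≤ K * S + M2 * (b - a) := by
  have h1 : ∫ x in a..b, |pdt v x t - pdx (pdx v) x t + v x t| ≤
      ∫ x in a..b, (u x t * S + M2) := by
    refine aux_mono hab ((H.cvt.sub H.cvxx).add H.cv).abs
      ((H.cu.mul continuousOn_const).add continuousOn_const) ?_
    intro x hx
    have hx' := Ioo_subset_Icc_self hx
    have h2 : pdt v x t - pdx (pdx v) x t + v x t = u x t * v x t + B2 x t := by
      have := H.veq x hx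
      linarith
    have hu := H.upos x hx'
    have hv := H.vpos x hx'
    have hb := hB2 x t
    rw [h2, abs_of_nonneg (by positivity)]
    have := mul_le_mul_of_nonneg_left (hS x hx') hu.le
    have := hM2 x t
    linarith
  have i1 := aux_ii hab H.cu
  rw [intervalIntegral.integral_add (i1.mul_const S) intervalIntegrable_const,
    intervalIntegral.integral_mul_const] at h1
  simp at h1
  have := mul_le_mul_of_nonneg_right hK hS0
  linarith

/-- The logarithmic inequality. -/
lemma aux_log {a b χ : ℝ} (hab : a < b) {B1 B2 : ℝ → ℝ → ℝ} {u v : ℝ → ℝ → ℝ} {t : ℝ}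
    (H : AuxFacts a b χ B1 B2 u v t) (hB2 : ∀ x t, 0 ≤ B2 x t)
    (c : ℝ) (hc : 0 < c) (hcB : c ≤ ∫ x in Ioo a b, B2 x t) :
    (∫ x in a..b, u x t) - (b - a) - (∫ x in a..b, Real.log (v x t)) / (b - a)
      ≤ (∫ x in a..b, pdt v x t / v x t) + ((b - a) - Real.log c) ∧
    (∫ x in a..b, u x t) - (b - a) ≤ ∫ x in a..b, pdt v x t / v x t := by
  have hL : 0 < b - a := by linarith
  have hne : ∀ x ∈ Icc a b, v x t ≠ 0 := fun x hx => (H.vpos x hx).ne'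
  obtain ⟨m, hm, hmax⟩ := isCompact_Icc.exists_isMaxOn (nonempty_Icc.2 hab.le) H.cv
  set S := v m t with hS
  have hSpos : 0 < S := H.vpos m hm
  set Z := ∫ x in a..b, (pdx v x t / v x t) ^ 2 with hZ
  have cz : ContinuousOn (fun x => pdx v x t / v x t) (Icc a b) := H.cvx.div H.cv hne
  have clog : ContinuousOn (fun x => Real.log (v x t)) (Icc a b) := H.cv.log hne
  -- the source term
  set f : ℝ → ℝ := fun x => pdt v x t - pdx (pdx v) x t - u x t * v x t + v x t with hf
  have cf : ContinuousOn f (Icc a b) := ((H.cvt.sub H.cvxx).sub (H.cu.fun_mul H.cv)).add H.cv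
  have hfB : ∀ x ∈ Ioo a b, f x = B2 x t := by
    intro x hx
    have := H.veq x hx
    simp only [hf]; linarith
  have hcf : c ≤ ∫ x in a..b, f x := by
    rw [intervalIntegral.integral_of_le hab.le, integral_Ioc_eq_integral_Ioo,
      setIntegral_congr_fun measurableSet_Ioo hfB]
    exact hcB
  have hcS : c / S ≤ ∫ x in a..b, f x / v x t := by
    have h1 : ∫ x in a..b, f x / S ≤ ∫ x in a..b, f x / v x t := by
      refine aux_mono hab (cf.div_const S) (aux_div cf H.cv hne) ?_
      intro x hx
      have hx' := Ioo_subset_Icc_self hx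
      have h0 : 0 ≤ f x := by rw [hfB x hx]; exact hB2 x t
      exact div_le_div_of_nonneg_left h0 (H.vpos x hx') (hmax hx')
    rw [intervalIntegral.integral_div] at h1
    exact (div_le_div_of_nonneg_right hcf hSpos.le).trans h1
  -- integration by parts
  have hibp : ∫ x in a..b, pdx (pdx v) x t / v x t = Z := by
    have hd : ∀ x ∈ Icc a b, HasDerivAt (fun y => pdx v y t / v y t)
        (pdx (pdx v) x t / v x t - (pdx v x t / v x t) ^ 2) x := by
      intro x hx
      have h := (H.dvxx x hx).div (H.dvx x hx) (hne x hx)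
      have hv := hne x hx
      refine h.congr_deriv ?_
      field_simp
    have h := intervalIntegral.integral_eq_sub_of_hasDerivAt (a := a) (b := b)
      (by rw [uIcc_of_le hab.le]; exact hd)
      (aux_ii hab ((aux_div H.cvxx H.cv hne).fun_sub (cz.fun_pow 2)))
    rw [intervalIntegral.integral_sub (aux_ii hab (aux_div H.cvxx H.cv hne)) (aux_ii hab (cz.fun_pow 2)),
      H.va, H.vb] at h
    simp at h
    linarith
  -- the time derivative
  have hdt : ∫ x in a..b, pdt v x t / v x t
      = Z + (∫ x in a..b, u x t) - (b - a) + ∫ x in a..b, f x / v x t := by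
    have e : ∫ x in a..b, pdt v x t / v x t
        = ∫ x in a..b, (pdx (pdx v) x t / v x t + u x t - 1 + f x / v x t) := by
      refine intervalIntegral.integral_congr ?_
      rw [uIcc_of_le hab.le]
      intro x hx
      have := hne x hx
      simp only [hf]
      field_simp
      ring
    have i1 := aux_ii hab (aux_div H.cvxx H.cv hne)
    have i2 := aux_ii hab H.cu
    have i3 := aux_ii hab (aux_div cf H.cv hne)
    rw [e, intervalIntegral.integral_add ((i1.add i2).sub intervalIntegrable_const) i3,
      intervalIntegral.integral_sub (i1.add i2) intervalIntegrable_const,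
      intervalIntegral.integral_add i1 i2, hibp]
    simp
  -- lower bound of the logarithm
  have hlog : ∀ x ∈ Icc a b, Real.log S - ((b - a) + Z) ≤ Real.log (v x t) := by
    intro x hx
    have hdl : ∀ x ∈ Icc a b, HasDerivAt (fun y => Real.log (v y t)) (pdx v x t / v x t) x :=
      fun x hx => (H.dvx x hx).log (hne x hx)
    have hsub : uIcc x m ⊆ Icc a b := uIcc_subset_Icc hx hm
    have e : ∫ y in x..m, pdx v y t / v y t = Real.log S - Real.log (v x t) :=
      intervalIntegral.integral_eq_sub_of_hasDerivAt (fun y hy => hdl y (hsub hy))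
        ((cz.mono hsub).intervalIntegrable)
    have hIsub : uIoc x m ⊆ Ioc a b := by
      intro y hy
      rw [uIoc, mem_Ioc] at hy
      exact ⟨lt_of_le_of_lt (le_min hx.1 hm.1) hy.1, hy.2.trans (max_le hx.2 hm.2)⟩
    have h1 : |∫ y in x..m, pdx v y t / v y t| ≤ (b - a) + Z :=
      calc |∫ y in x..m, pdx v y t / v y t| ≤ ∫ y in uIoc x m, ‖pdx v y t / v y t‖ := by
            rw [← Real.norm_eq_abs]; exact intervalIntegral.norm_integral_le_integral_norm_uIoc
        _ ≤ ∫ y in Ioc a b, ‖pdx v y t / v y t‖ := by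
            refine setIntegral_mono_set
              (cz.norm.integrableOn_Icc.mono_set Ioc_subset_Icc_self) ?_ (Eventually.of_forall hIsub)
            exact Eventually.of_forall fun y => norm_nonneg _
        _ = ∫ y in a..b, |pdx v y t / v y t| := by
            rw [intervalIntegral.integral_of_le hab.le]; rfl
        _ ≤ ∫ y in a..b, (1 + (pdx v y t / v y t) ^ 2) := by
            refine aux_mono hab cz.abs (continuousOn_const.add (cz.fun_pow 2)) ?_
            intro y _
            rw [← sq_abs (pdx v y t / v y t)]
            nlinarith [sq_nonneg (|pdx v y t / v y t| - 1), abs_nonneg (pdx v y t / v y t)]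
        _ = (b - a) + Z := by
            rw [intervalIntegral.integral_add intervalIntegrable_const (aux_ii hab (cz.fun_pow 2))]
            simp [hZ]
    have := le_abs_self (∫ y in x..m, pdx v y t / v y t)
    linarith
  have hlogint : (b - a) * (Real.log S - ((b - a) + Z)) ≤ ∫ x in a..b, Real.log (v x t) := by
    have := aux_mono hab continuousOn_const clog (fun x hx => hlog x (Ioo_subset_Icc_self hx))
    rwa [intervalIntegral.integral_const, smul_eq_mul] at this
  have hlogdiv : Real.log S - ((b - a) + Z) ≤ (∫ x in a..b, Real.log (v x t)) / (b - a) := by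
    rw [le_div_iff₀ hL]; linarith
  have hlc : Real.log (c / S) ≤ c / S - 1 := Real.log_le_sub_one_of_pos (by positivity)
  rw [Real.log_div hc.ne' hSpos.ne'] at hlc
  have hZ0 : 0 ≤ Z := intervalIntegral.integral_nonneg hab.le (fun x _ => sq_nonneg _)
  have hcS0 : 0 ≤ c / S := by positivity
  exact ⟨by linarith, by linarith⟩

/-- Differentiation of `∫ (u + v)`. -/
lemma aux_deriv_mass {a b χ : ℝ} (hab : a < b) {B1 B2 : ℝ → ℝ → ℝ} {u0 v0 : ℝ → ℝ}
    {u v : ℝ → ℝ → ℝ} {Tmax : ℝ≥0∞} (hsol : CrimeSol a b χ B1 B2 u0 v0 u v Tmax)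
    {t : ℝ} (ht : t ∈ It' Tmax) :
    HasDerivAt (fun s => ∫ x in a..b, (u x s + v x s))
      ((∫ x in a..b, pdt u x t) + ∫ x in a..b, pdt v x t) t := by
  have H := aux_facts hsol ht
  rw [← intervalIntegral.integral_add (aux_ii hab H.cut) (aux_ii hab H.cvt)]
  refine aux_deriv_integral a b hab (It' Tmax) (aux_It'_open Tmax) (fun x s => u x s + v x s)
    (fun x s => pdt u x s + pdt v x s) ?_ ?_ ?_ t ht
  · intro s hs
    have H := aux_facts hsol hs
    exact H.cu.add H.cv
  · exact hsol.u_cont21.snd.snd.add hsol.v_cont21.snd.snd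
  · intro x hx s hs
    exact (hsol.u_reg x hx s hs).2.2.hasDerivAt.add (hsol.v_reg x hx s hs).2.2.hasDerivAt

lemma aux_deriv_log {a b χ : ℝ} (hab : a < b) {B1 B2 : ℝ → ℝ → ℝ} {u0 v0 : ℝ → ℝ}
    {u v : ℝ → ℝ → ℝ} {Tmax : ℝ≥0∞} (hsol : CrimeSol a b χ B1 B2 u0 v0 u v Tmax)
    {t : ℝ} (ht : t ∈ It' Tmax) :
    HasDerivAt (fun s => ∫ x in a..b, Real.log (v x s))
      (∫ x in a..b, pdt v x t / v x t) t := by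
  refine aux_deriv_integral a b hab (It' Tmax) (aux_It'_open Tmax) (fun x s => Real.log (v x s))
    (fun x s => pdt v x s / v x s) ?_ ?_ ?_ t ht
  · intro s hs
    have H := aux_facts hsol hs
    exact H.cv.log (fun x hx => (H.vpos x hx).ne')
  · refine hsol.v_cont21.snd.snd.div (hsol.v_cont.mono ?_) ?_
    · exact Set.prod_mono_right (fun s hs => ⟨hs.1.le, hs.2⟩)
    · intro p hp
      exact (hsol.v_pos p.1 hp.1 p.2 hp.2).ne'
  · intro x hx s hs
    exact (hsol.v_reg x hx s hs).2.2.hasDerivAt.log (hsol.v_pos x hx s hs).ne'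

/-- Linear growth bound of the total mass. -/
lemma aux_mass_growth {a b χ : ℝ} (hab : a < b) {B1 B2 : ℝ → ℝ → ℝ} {u0 v0 : ℝ → ℝ}
    {u v : ℝ → ℝ → ℝ} {Tmax : ℝ≥0∞} (hsol : CrimeSol a b χ B1 B2 u0 v0 u v Tmax)
    (M1 M2 : ℝ) (hM1 : ∀ x t, B1 x t ≤ M1) (hM2 : ∀ x t, B2 x t ≤ M2)
    {t0 t1 : ℝ} (h0 : t0 ∈ It' Tmax) (h1 : t1 ∈ It' Tmax) (h01 : t0 ≤ t1) :
    ∫ x in a..b, (u x t1 + v x t1)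
      ≤ (∫ x in a..b, (u x t0 + v x t0)) + (M1 + M2) * (b - a) * (t1 - t0) := by
  have hd := fun t (ht : t ∈ Icc t0 t1) => aux_deriv_mass hab hsol (aux_It'_mono h0 h1 ht)
  have := (convex_Icc t0 t1).image_sub_le_mul_sub_of_deriv_le
    (f := fun s => ∫ x in a..b, (u x s + v x s)) (C := (M1 + M2) * (b - a))
    (fun t ht => (hd t ht).continuousAt.continuousWithinAt)
    (fun t ht => (hd t (interior_subset ht)).differentiableAt.differentiableWithinAt)
    (by
      intro t ht
      have ht' := interior_subset ht
      rw [(hd t ht').deriv]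
      have H := aux_facts hsol (aux_It'_mono h0 h1 ht')
      have e1 := aux_mass_u hab H M1 hM1
      have e2 := aux_mass_v hab H M2 hM2
      have e3 : 0 ≤ ∫ x in a..b, v x t :=
        intervalIntegral.integral_nonneg hab.le (fun x hx => (H.vpos x hx).le)
      linarith)
    t0 (left_mem_Icc.2 h01) t1 (right_mem_Icc.2 h01) h01
  linarith

/-- Uniform bound of the total mass under (H2). -/
lemma aux_mass_uniform {a b χ : ℝ} (hab : a < b) {B1 B2 : ℝ → ℝ → ℝ} {u0 v0 : ℝ → ℝ}
    {u v : ℝ → ℝ → ℝ} {Tmax : ℝ≥0∞} (hsol : CrimeSol a b χ B1 B2 u0 v0 u v Tmax)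
    (M1 M2 : ℝ) (hM1 : ∀ x t, B1 x t ≤ M1) (hM2 : ∀ x t, B2 x t ≤ M2)
    (hB2 : ∀ x t, 0 ≤ B2 x t) (hH2 : HypH2 a b B2) {t0 : ℝ} (h0 : t0 ∈ It' Tmax) :
    ∃ K, ∀ t1 ∈ It' Tmax, t0 ≤ t1 → ∫ x in a..b, (u x t1 + v x t1) ≤ K := by
  obtain ⟨c, hc, hcB⟩ := hH2
  have hL : 0 < b - a := by linarith
  set E : ℝ → ℝ := fun s => (∫ x in a..b, (u x s + v x s)) - ∫ x in a..b, Real.log (v x s) with hE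
  set δ : ℝ := min 1 (1 / (b - a)) with hδ
  have hδ0 : 0 < δ := lt_min one_pos (by positivity)
  set A : ℝ := |(M1 + M2) * (b - a)| + (b - a) + |(b - a) - Real.log c| with hA
  have hA0 : 0 ≤ A := by positivity
  refine ⟨2 * (|E t0| + A / δ), ?_⟩
  intro t1 h1 h01
  have key : E t1 ≤ |E t0| + A / δ := by
    refine aux_gronwall E (fun t => ((∫ x in a..b, pdt u x t) + ∫ x in a..b, pdt v x t)
      - ∫ x in a..b, pdt v x t / v x t) δ A t0 t1 hδ0 hA0 h01 ?_ ?_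
    · intro t ht
      have ht' := aux_It'_mono h0 h1 ht
      exact (aux_deriv_mass hab hsol ht').sub (aux_deriv_log hab hsol ht')
    · intro t ht
      have ht' := aux_It'_mono h0 h1 ht
      have H := aux_facts hsol ht'
      have e1 := aux_mass_u hab H M1 hM1
      have e2 := aux_mass_v hab H M2 hM2
      obtain ⟨e3, e3'⟩ := aux_log hab H hB2 c hc (hcB t ht'.1)
      have e4 : 0 ≤ ∫ x in a..b, v x t :=
        intervalIntegral.integral_nonneg hab.le (fun x hx => (H.vpos x hx).le)
      have e5 : 0 ≤ ∫ x in a..b, u x t :=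
        intervalIntegral.integral_nonneg hab.le (fun x hx => (H.upos x hx).le)
      -- we need `δ * E t ≤ ∫ u + ∫ v + (stuff)`
      have e6 : ∫ x in a..b, (u x t + v x t) = (∫ x in a..b, u x t) + ∫ x in a..b, v x t :=
        intervalIntegral.integral_add (aux_ii hab H.cu) (aux_ii hab H.cv)
      set N := ∫ x in a..b, Real.log (v x t) with hN
      have hδ1 : δ ≤ 1 := min_le_left _ _
      have hδ2 : δ ≤ 1 / (b - a) := min_le_right _ _
      have e7 : δ * (∫ x in a..b, (u x t + v x t)) ≤ (∫ x in a..b, u x t) + ∫ x in a..b, v x t := by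
        rw [e6]
        exact mul_le_of_le_one_left (by positivity) hδ1
      have a1 := le_abs_self ((M1 + M2) * (b - a))
      have a2 := le_abs_self ((b - a) - Real.log c)
      have a3 := abs_nonneg ((b - a) - Real.log c)
      have e9 : δ * E t = δ * (∫ x in a..b, (u x t + v x t)) - δ * N := by
        simp only [hE]; ring
      rw [e9]
      by_cases hNs : N ≤ 0
      · have e8 : -(δ * N) ≤ -(N / (b - a)) := by
          have := mul_le_mul_of_nonneg_right hδ2 (neg_nonneg.2 hNs)
          rw [div_mul_eq_mul_div, one_mul, neg_div] at this
          linarith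
        linarith
      · push Not at hNs
        have e8 : 0 ≤ δ * N := by positivity
        linarith
  have H := aux_facts hsol h1
  have hlog : ∫ x in a..b, Real.log (v x t1) ≤ ∫ x in a..b, (u x t1 + v x t1) / 2 := by
    refine aux_mono hab (H.cv.log (fun x hx => (H.vpos x hx).ne'))
      ((H.cu.add H.cv).div_const 2) ?_
    intro x hx
    have hv := H.vpos x (Ioo_subset_Icc_self hx)
    have hu := H.upos x (Ioo_subset_Icc_self hx)
    have h2 := Real.log_le_sub_one_of_pos (half_pos hv)
    rw [Real.log_div hv.ne' two_ne_zero] at h2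
    have := Real.log_two_lt_d9
    linarith
  rw [intervalIntegral.integral_div] at hlog
  simp only [hE] at key
  linarith

/-- First integration by parts. -/
lemma aux_ibp1 {a b χ : ℝ} (hab : a < b) {B1 B2 : ℝ → ℝ → ℝ} {u v : ℝ → ℝ → ℝ} {t : ℝ}
    (H : AuxFacts a b χ B1 B2 u v t) (lam : ℝ) (hlam : Real.sin (lam * (b - a)) = 0) :
    ∫ x in a..b, pdx v x t * Real.sin (lam * (x - a))
      = - lam * ∫ x in a..b, v x t * Real.cos (lam * (x - a)) := by
  have cs : ContinuousOn (fun x => Real.sin (lam * (x - a))) (Icc a b) := by fun_prop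
  have cc : ContinuousOn (fun x => Real.cos (lam * (x - a))) (Icc a b) := by fun_prop
  have hd : ∀ x ∈ Icc a b, HasDerivAt (fun x => v x t * Real.sin (lam * (x - a)))
      (pdx v x t * Real.sin (lam * (x - a)) + lam * (v x t * Real.cos (lam * (x - a)))) x := by
    intro x hx
    have h1 : HasDerivAt (fun x => lam * (x - a)) lam x := by
      simpa using ((hasDerivAt_id x).sub_const a).const_mul lam
    refine ((H.dvx x hx).mul h1.sin).congr_deriv ?_
    ring
  have i1 := aux_ii hab (H.cvx.fun_mul cs)
  have i2 := aux_ii hab (H.cv.fun_mul cc)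
  have h := intervalIntegral.integral_eq_sub_of_hasDerivAt (a := a) (b := b)
      (by rw [uIcc_of_le hab.le]; exact hd) (i1.add (i2.const_mul lam))
  rw [intervalIntegral.integral_add i1 (i2.const_mul lam), intervalIntegral.integral_const_mul,
    hlam] at h
  simp at h
  linarith

/-- Second integration by parts. -/
lemma aux_ibp2 {a b χ : ℝ} (hab : a < b) {B1 B2 : ℝ → ℝ → ℝ} {u v : ℝ → ℝ → ℝ} {t : ℝ}
    (H : AuxFacts a b χ B1 B2 u v t) (lam : ℝ) :
    ∫ x in a..b, pdx (pdx v) x t * Real.cos (lam * (x - a))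
      = lam * ∫ x in a..b, pdx v x t * Real.sin (lam * (x - a)) := by
  have cs : ContinuousOn (fun x => Real.sin (lam * (x - a))) (Icc a b) := by fun_prop
  have cc : ContinuousOn (fun x => Real.cos (lam * (x - a))) (Icc a b) := by fun_prop
  have hd : ∀ x ∈ Icc a b, HasDerivAt (fun x => pdx v x t * Real.cos (lam * (x - a)))
      (pdx (pdx v) x t * Real.cos (lam * (x - a))
        + (-lam) * (pdx v x t * Real.sin (lam * (x - a)))) x := by
    intro x hx
    have h1 : HasDerivAt (fun x => lam * (x - a)) lam x := by
      simpa using ((hasDerivAt_id x).sub_const a).const_mul lam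
    refine ((H.dvxx x hx).mul h1.cos).congr_deriv ?_
    ring
  have i1 := aux_ii hab (H.cvxx.fun_mul cc)
  have i2 := aux_ii hab (H.cvx.fun_mul cs)
  have h := intervalIntegral.integral_eq_sub_of_hasDerivAt (a := a) (b := b)
      (by rw [uIcc_of_le hab.le]; exact hd) (i1.add (i2.const_mul (-lam)))
  rw [intervalIntegral.integral_add i1 (i2.const_mul (-lam)), intervalIntegral.integral_const_mul,
    H.va, H.vb] at h
  simp at h
  linarith

/-- Bound on a single sine coefficient of `v_x`. -/
lemma aux_coeff {a b χ : ℝ} (hab : a < b) {B1 B2 : ℝ → ℝ → ℝ} {u0 v0 : ℝ → ℝ}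
    {u v : ℝ → ℝ → ℝ} {Tmax : ℝ≥0∞} (hsol : CrimeSol a b χ B1 B2 u0 v0 u v Tmax)
    {t0 t1 : ℝ} (h0 : t0 ∈ It' Tmax) (h1 : t1 ∈ It' Tmax) (h01 : t0 ≤ t1)
    (F : ℝ) (hF0 : 0 ≤ F)
    (hF : ∀ t ∈ Icc t0 t1, ∫ x in a..b, |pdt v x t - pdx (pdx v) x t + v x t| ≤ F)
    (lam : ℝ) (hlam : Real.sin (lam * (b - a)) = 0) :
    |∫ x in a..b, pdx v x t1 * Real.sin (lam * (x - a))|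
      ≤ |∫ x in a..b, pdx v x t0 * Real.sin (lam * (x - a))| + F / |lam| := by
  by_cases hl : lam = 0
  · subst hl; simp
  set c : ℝ → ℝ := fun t => ∫ x in a..b, v x t * Real.cos (lam * (x - a)) with hc
  set c' : ℝ → ℝ := fun t => ∫ x in a..b, pdt v x t * Real.cos (lam * (x - a)) with hc'
  have cc : ContinuousOn (fun x => Real.cos (lam * (x - a))) (Icc a b) := by fun_prop
  have hd : ∀ t ∈ Icc t0 t1, HasDerivAt c (c' t) t := by
    intro t ht
    have ht' := aux_It'_mono h0 h1 ht
    refine aux_deriv_integral a b hab (It' Tmax) (aux_It'_open Tmax)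
      (fun x s => v x s * Real.cos (lam * (x - a)))
      (fun x s => pdt v x s * Real.cos (lam * (x - a))) ?_ ?_ ?_ t ht'
    · intro s hs
      exact (aux_facts hsol hs).cv.mul cc
    · exact hsol.v_cont21.snd.snd.mul (by fun_prop)
    · intro x hx s hs
      exact (hsol.v_reg x hx s hs).2.2.hasDerivAt.mul_const _
  set μ := lam ^ 2 + 1 with hμ
  have hμ0 : 0 < μ := by positivity
  have hbd : ∀ t ∈ Icc t0 t1, |c' t + μ * c t| ≤ F := by
    intro t ht
    have H := aux_facts hsol (aux_It'_mono h0 h1 ht)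
    have e1 := aux_ibp1 hab H lam hlam
    have e2 := aux_ibp2 hab H lam
    have i1 := aux_ii hab (H.cvt.fun_mul cc)
    have i2 := aux_ii hab (H.cvxx.fun_mul cc)
    have i3 := aux_ii hab (H.cv.fun_mul cc)
    have e3 : c' t + μ * c t
        = ∫ x in a..b, (pdt v x t - pdx (pdx v) x t + v x t) * Real.cos (lam * (x - a)) := by
      have : ∫ x in a..b, (pdt v x t - pdx (pdx v) x t + v x t) * Real.cos (lam * (x - a))
          = ∫ x in a..b, (pdt v x t * Real.cos (lam * (x - a))
            - pdx (pdx v) x t * Real.cos (lam * (x - a)) + v x t * Real.cos (lam * (x - a))) := by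
        congr 1; funext x; ring
      rw [this, intervalIntegral.integral_add (i1.sub i2) i3, intervalIntegral.integral_sub i1 i2,
        e2, e1]
      simp only [hc, hc', hμ]; ring
    rw [e3]
    refine (intervalIntegral.abs_integral_le_integral_abs hab.le).trans (le_trans ?_ (hF t ht))
    have cf := (H.cvt.fun_sub H.cvxx).fun_add H.cv
    refine aux_mono hab (cf.fun_mul cc).abs cf.abs ?_
    intro x _
    rw [abs_mul]
    exact mul_le_of_le_one_right (abs_nonneg _) (Real.abs_cos_le_one _)
  have hup : c t1 ≤ |c t0| + F / μ :=
    aux_gronwall c c' μ F t0 t1 hμ0 hF0 h01 hd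
      (fun t ht => by linarith [(abs_le.1 (hbd t ht)).2])
  have hlo : -c t1 ≤ |c t0| + F / μ := by
    have := aux_gronwall (fun t => - c t) (fun t => - c' t) μ F t0 t1 hμ0 hF0 h01
      (fun t ht => (hd t ht).neg) (fun t ht => by
        have := (abs_le.1 (hbd t ht)).1
        linarith)
    simpa using this
  have habs : |c t1| ≤ |c t0| + F / μ := abs_le.2 ⟨by linarith, hup⟩
  rw [aux_ibp1 hab (aux_facts hsol h0) lam hlam, aux_ibp1 hab (aux_facts hsol h1) lam hlam,
    abs_mul, abs_mul, abs_neg]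
  have hla : 0 < |lam| := abs_pos.2 hl
  have h2 : |lam| * (F / μ) ≤ F / |lam| := by
    rw [le_div_iff₀ hla]
    have : |lam| * (F / μ) * |lam| = F * (|lam| ^ 2 / μ) := by ring
    rw [this, sq_abs]
    refine mul_le_of_le_one_right hF0 ?_
    rw [div_le_one hμ0, hμ]; linarith
  calc |lam| * |c t1| ≤ |lam| * (|c t0| + F / μ) := by gcongr
    _ = |lam| * |c t0| + |lam| * (F / μ) := by ring
    _ ≤ _ := by linarith

/-- The constant in the Fourier estimate. -/
def auxQ (L : ℝ) : ℝ := 2 * L / π ^ 2 * ∑' n : ℤ, 1 / (n : ℝ) ^ 2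

lemma auxQ_nonneg (L : ℝ) (hL : 0 < L) : 0 ≤ auxQ L := by
  unfold auxQ
  have : 0 ≤ ∑' n : ℤ, 1 / (n : ℝ) ^ 2 := tsum_nonneg (fun n => by positivity)
  positivity

lemma aux_fourier {a b χ : ℝ} (hab : a < b) {B1 B2 : ℝ → ℝ → ℝ} {u0 v0 : ℝ → ℝ}
    {u v : ℝ → ℝ → ℝ} {Tmax : ℝ≥0∞} (hsol : CrimeSol a b χ B1 B2 u0 v0 u v Tmax)
    {t0 t1 : ℝ} (h0 : t0 ∈ It' Tmax) (h1 : t1 ∈ It' Tmax) (h01 : t0 ≤ t1)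
    (F : ℝ) (hF0 : 0 ≤ F)
    (hF : ∀ t ∈ Icc t0 t1, ∫ x in a..b, |pdt v x t - pdx (pdx v) x t + v x t| ≤ F) :
    ∫ x in a..b, pdx v x t1 ^ 2 ≤ 2 * (∫ x in a..b, pdx v x t0 ^ 2) + auxQ (b - a) * F ^ 2 := by
  set L := b - a with hLdef
  have hL : 0 < L := by simp only [hLdef]; linarith
  have par : ∀ t ∈ It' Tmax, HasSum (fun n : ℤ =>
      (∫ x in a..b, pdx v x t * Real.sin (n * π / L * (x - a))) ^ 2 / L ^ 2)
      (1 / L * ∫ x in a..b, pdx v x t ^ 2) := by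
    intro t ht
    have H := aux_facts hsol ht
    have := aux_parseval L hL (fun y => pdx v (a + y) t)
      (by
        refine H.cvx.comp (f := fun y => a + y) (by fun_prop) ?_
        intro y hy
        exact ⟨by linarith [hy.1], by linarith [hy.2]⟩)
      (by simpa using H.va)
    convert this using 1
    · funext n
      congr 2
      have := intervalIntegral.integral_comp_add_left (a := 0) (b := L)
        (fun x => pdx v x t * Real.sin (n * π / L * (x - a))) a
      rw [show a + 0 = a by ring, show a + L = b by simp [hLdef]] at this
      rw [← this]
      congr 1; funext y; congr 3; ring
    · congr 1
      have := intervalIntegral.integral_comp_add_left (a := 0) (b := L)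
        (fun x => pdx v x t ^ 2) a
      rw [show a + 0 = a by ring, show a + L = b by simp [hLdef]] at this
      rw [← this]
  have s2 : HasSum (fun n : ℤ => 1 / (n : ℝ) ^ 2) (∑' n : ℤ, 1 / (n : ℝ) ^ 2) :=
    (Real.summable_one_div_int_pow.2 (by norm_num)).hasSum
  have hle := hasSum_le ?_ (par t1 h1) (((par t0 h0).mul_left 2).add (s2.mul_left (2 * F ^ 2 / π ^ 2)))
  · have e : ∫ x in a..b, pdx v x t1 ^ 2 = L * (1 / L * ∫ x in a..b, pdx v x t1 ^ 2) := by
      field_simp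
    rw [e]
    refine (mul_le_mul_of_nonneg_left hle hL.le).trans (le_of_eq ?_)
    unfold auxQ
    field_simp
  · intro n
    have hsin : Real.sin (n * π / L * (b - a)) = 0 := by
      rw [← hLdef, div_mul_cancel₀ _ hL.ne']
      exact Real.sin_int_mul_pi n
    have h := aux_coeff hab hsol h0 h1 h01 F hF0 hF (n * π / L) hsin
    set X := ∫ x in a..b, pdx v x t1 * Real.sin (n * π / L * (x - a))
    set Y := ∫ x in a..b, pdx v x t0 * Real.sin (n * π / L * (x - a))
    have h2 : X ^ 2 ≤ 2 * Y ^ 2 + 2 * (F / |n * π / L|) ^ 2 := by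
      have h3 : X ^ 2 ≤ (|Y| + F / |n * π / L|) ^ 2 := by
        rw [← sq_abs X]
        exact pow_le_pow_left₀ (abs_nonneg _) h 2
      rw [← sq_abs Y]
      nlinarith [sq_nonneg (|Y| - F / |n * π / L|)]
    have h4 : (F / |n * π / L|) ^ 2 = F ^ 2 * L ^ 2 / π ^ 2 * (1 / (n:ℝ) ^ 2) := by
      rw [div_pow, sq_abs]
      by_cases hn : (n : ℝ) = 0
      · simp [hn]
      · have := Real.pi_pos.ne'
        field_simp
    rw [h4] at h2
    rw [div_le_iff₀ (by positivity)]
    refine h2.trans (le_of_eq ?_)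
    have := hL.ne'
    field_simp

lemma aux_main {a b χ : ℝ} (hab : a < b) {B1 B2 : ℝ → ℝ → ℝ} {u0 v0 : ℝ → ℝ}
    {u v : ℝ → ℝ → ℝ} {Tmax : ℝ≥0∞} (hsol : CrimeSol a b χ B1 B2 u0 v0 u v Tmax)
    (M2 : ℝ) (hM2 : ∀ x t, B2 x t ≤ M2) (hB2 : ∀ x t, 0 ≤ B2 x t)
    {t0 : ℝ} (h0 : t0 ∈ It' Tmax) (K : ℝ) (hK0 : 0 ≤ K) :
    ∃ C : ℝ, ∀ t1 ∈ It' Tmax, t0 ≤ t1 →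
      (∀ t ∈ Icc t0 t1, ∫ x in a..b, (u x t + v x t) ≤ K) →
      ∫ x in a..b, pdx v x t1 ^ 2 ≤ C := by
  have hL : 0 < b - a := by linarith
  have hM20 : 0 ≤ M2 := (hB2 0 0).trans (hM2 0 0)
  set Q := auxQ (b - a) with hQ
  have hQ0 : 0 ≤ Q := auxQ_nonneg _ hL
  set l : ℝ := min ((b - a) / 2) (1 / (16 * Q * K ^ 2 + 1)) with hl
  have hl0 : 0 < l := lt_min (by positivity) (by positivity)
  have hl1 : l ≤ (b - a) / 2 := min_le_left _ _
  have hl2 : 16 * Q * K ^ 2 * l ≤ 1 := by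
    have h : l ≤ 1 / (16 * Q * K ^ 2 + 1) := min_le_right _ _
    rw [le_div_iff₀ (by positivity)] at h
    linarith
  set D : ℝ → ℝ := fun t => ∫ x in a..b, pdx v x t ^ 2 with hD
  set W : ℝ := K * (K / l) + M2 * (b - a) with hW
  have hW0 : 0 ≤ W := by positivity
  refine ⟨4 * D t0 + 4 * Q * W ^ 2 + 1, ?_⟩
  intro t1 h1 h01 hmass
  have hDc : ContinuousOn D (Icc t0 t1) := by
    have h2 := (hsol.v_W1r 2 (by norm_num)).2
    have e : D = fun t => ∫ x in Set.Ioo a b, |pdx v x t| ^ (2:ℝ) := by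
      funext t
      simp only [hD]
      rw [intervalIntegral.integral_of_le hab.le, integral_Ioc_eq_integral_Ioo]
      congr 1
      funext x
      rw [Real.rpow_two, sq_abs]
    rw [e]
    refine h2.mono ?_
    intro t ht
    have := aux_It'_mono h0 h1 ht
    exact ⟨this.1.le, this.2⟩
  obtain ⟨tm, htm, hmax⟩ := isCompact_Icc.exists_isMaxOn (nonempty_Icc.2 h01) hDc
  set M := D tm with hM
  have hM0 : 0 ≤ M := intervalIntegral.integral_nonneg hab.le (fun x _ => sq_nonneg _)
  set ρ : ℝ := Real.sqrt (l * (M + 1)) with hρ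
  have hρ0 : 0 < ρ := Real.sqrt_pos.2 (by positivity)
  have hρ2 : ρ ^ 2 = l * (M + 1) := Real.sq_sqrt (by positivity)
  set S : ℝ := K / l + 2 * ρ with hS
  have hS0 : 0 ≤ S := by positivity
  have htm' := aux_It'_mono h0 h1 htm
  have hfour := aux_fourier hab hsol h0 htm' htm.1 (K * S + M2 * (b - a)) (by positivity) (by
    intro t ht
    have ht1 : t ∈ Icc t0 t1 := ⟨ht.1, ht.2.trans htm.2⟩
    have H := aux_facts hsol (aux_It'_mono h0 h1 ht1)
    have hm := hmass t ht1
    rw [intervalIntegral.integral_add (aux_ii hab H.cu) (aux_ii hab H.cv)] at hm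
    have e4 : 0 ≤ ∫ x in a..b, v x t :=
      intervalIntegral.integral_nonneg hab.le (fun x hx => (H.vpos x hx).le)
    have e5 : 0 ≤ ∫ x in a..b, u x t :=
      intervalIntegral.integral_nonneg hab.le (fun x hx => (H.upos x hx).le)
    refine aux_source hab H M2 hM2 hB2 K S hS0 ?_ (by linarith)
    intro x hx
    have hθ : 0 < ρ / l := by positivity
    have h2 := aux_sup_bound a b (fun x => v x t) (fun x => pdx v x t) H.dvx H.cvx
      (fun x hx => (H.vpos x hx).le) l hl0 hl1 x hx (ρ / l) hθ
    have h3 : (∫ y in a..b, v y t) / l ≤ K / l := by gcongr; linarith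
    have h4 : ρ / l * l = ρ := by field_simp
    have h5 : (∫ y in a..b, pdx v y t ^ 2) / (ρ / l) ≤ ρ := by
      rw [div_le_iff₀ hθ]
      have h6 : D t ≤ M := hmax ht1
      have h7 : ρ * (ρ / l) = M + 1 := by
        rw [← mul_div_assoc, ← pow_two, hρ2]; field_simp
      rw [h7]
      simp only [hD] at h6
      linarith
    simp only [hS]
    linarith)
  have hfin : M ≤ 4 * D t0 + 4 * Q * W ^ 2 + 1 := by
    have e1 : K * S + M2 * (b - a) = W + 2 * K * ρ := by simp only [hS, hW]; ring
    rw [e1] at hfour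
    have e2 : (W + 2 * K * ρ) ^ 2 ≤ 2 * W ^ 2 + 8 * K ^ 2 * (l * (M + 1)) := by
      rw [← hρ2]
      nlinarith [sq_nonneg (W - 2 * K * ρ)]
    have e3 : Q * (W + 2 * K * ρ) ^ 2 ≤ 2 * Q * W ^ 2 + (M + 1) / 2 := by
      refine (mul_le_mul_of_nonneg_left e2 hQ0).trans ?_
      have := mul_le_mul_of_nonneg_right hl2 (by positivity : 0 ≤ (M + 1) / 2)
      nlinarith
    have e4 : M ≤ 2 * D t0 + Q * (W + 2 * K * ρ) ^ 2 := hfour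
    linarith
  have : D t1 ≤ M := hmax (right_mem_Icc.2 h01)
  exact this.trans hfin

lemma aux_conclude {a b χ : ℝ} (hab : a < b) {B1 B2 : ℝ → ℝ → ℝ} {u0 v0 : ℝ → ℝ}
    {u v : ℝ → ℝ → ℝ} {Tmax : ℝ≥0∞} (hsol : CrimeSol a b χ B1 B2 u0 v0 u v Tmax)
    (M2 : ℝ) (hM2 : ∀ x t, B2 x t ≤ M2) (hB2 : ∀ x t, 0 ≤ B2 x t)
    {t0 : ℝ} (h0 : t0 ∈ It' Tmax) (K : ℝ) (r : ℝ) (hr1 : 1 < r) (hr2 : r < 3/2) :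
    ∃ C : ℝ, 0 < C ∧ ∀ t1 ∈ It' Tmax,
      (∀ t ∈ Icc t0 t1, ∫ x in a..b, (u x t + v x t) ≤ K) →
      (∫ x in Set.Ioo a b, |pdx v x t1| ^ r) ^ (1/r) ≤ C := by
  have hL : 0 < b - a := by linarith
  obtain ⟨C1, hC1⟩ := aux_main hab hsol M2 hM2 hB2 h0 (max K 0) (le_max_right _ _)
  have hsub : Icc 0 t0 ⊆ It Tmax := by
    intro t ht
    exact ⟨ht.1, lt_of_le_of_lt (ENNReal.ofReal_le_ofReal ht.2) h0.2⟩
  obtain ⟨C2, hC2⟩ := isCompact_Icc.exists_bound_of_continuousOn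
    ((hsol.v_W1r r hr1).2.mono hsub)
  set R := max (C1 + (b - a)) C2 with hR
  have hnn : ∀ t, 0 ≤ ∫ x in Set.Ioo a b, |pdx v x t| ^ r := fun t =>
    integral_nonneg (fun x => by positivity)
  have hmain : ∀ t1 ∈ It' Tmax,
      (∀ t ∈ Icc t0 t1, ∫ x in a..b, (u x t + v x t) ≤ K) →
      ∫ x in Set.Ioo a b, |pdx v x t1| ^ r ≤ R := by
    intro t1 h1 hm
    rcases le_total t1 t0 with h | h
    · have := hC2 t1 ⟨h1.1.le, h⟩
      exact ((le_abs_self _).trans this).trans (le_max_right _ _)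
    · have h2 := hC1 t1 h1 h (fun t ht => (hm t ht).trans (le_max_left _ _))
      have H := aux_facts hsol h1
      refine le_trans ?_ (le_max_left _ _)
      rw [← integral_Ioc_eq_integral_Ioo, ← intervalIntegral.integral_of_le hab.le]
      have h3 : ∫ x in a..b, |pdx v x t1| ^ r ≤ ∫ x in a..b, (pdx v x t1 ^ 2 + 1) := by
        refine aux_mono hab (H.cvx.abs.rpow_const (fun x _ => Or.inr (by linarith)))
          ((H.cvx.fun_pow 2).fun_add continuousOn_const) ?_
        intro x _
        rw [← sq_abs]
        have hy := abs_nonneg (pdx v x t1)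
        set y := |pdx v x t1|
        rcases le_total y 1 with h4 | h4
        · have := Real.rpow_le_one hy h4 (by linarith : 0 ≤ r)
          nlinarith [sq_nonneg y]
        · have := Real.rpow_le_rpow_of_exponent_le h4 (by linarith : r ≤ 2)
          rw [Real.rpow_two] at this
          linarith
      rw [intervalIntegral.integral_add (aux_ii hab (H.cvx.fun_pow 2)) intervalIntegrable_const] at h3
      simp at h3
      linarith
  refine ⟨|R| ^ (1/r) + 1, by positivity, ?_⟩
  intro t1 h1 hm
  have h5 := Real.rpow_le_rpow (hnn t1) ((hmain t1 h1 hm).trans (le_abs_self R))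
    (by positivity : 0 ≤ 1 / r)
  linarith

/-- Lemma 4.2 (bound on `‖v_x(·,t)‖_{L^r(Ω)}` for small `r > 1`). -/
theorem Lr_gradient_bound_for_v
    (a b χ : ℝ) (hab : a < b) (hχ : 0 < χ)
    (B1 B2 : ℝ → ℝ → ℝ) (hB1 : HypB a b B1) (hB2 : HypB a b B2)
    (u0 v0 : ℝ → ℝ) (hinit : HypInit a b u0 v0)
    (Tmax : ℝ≥0∞) (hT : 0 < Tmax)
    (u v : ℝ → ℝ → ℝ) (hsol : CrimeSol a b χ B1 B2 u0 v0 u v Tmax)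
    (r : ℝ) (hr1 : 1 < r) (hr2 : r < 3/2) (hr3 : r < 1 + 1 / (2 * χ^2)) :
    (∀ T : ℝ, 0 < T → ∃ C : ℝ, 0 < C ∧
      ∀ t : ℝ, 0 < t → ENNReal.ofReal t < min (ENNReal.ofReal T) Tmax →
        (∫ x in Set.Ioo a b, |pdx v x t| ^ r) ^ (1/r) ≤ C) ∧
    (HypH2 a b B2 → ∃ C : ℝ, 0 < C ∧
      ∀ t ∈ It' Tmax, (∫ x in Set.Ioo a b, |pdx v x t| ^ r) ^ (1/r) ≤ C) := by
  obtain ⟨-, ⟨M1, hM1⟩, -⟩ := hB1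
  obtain ⟨hB2n, ⟨M2, hM2⟩, -⟩ := hB2
  obtain ⟨t0, h0⟩ : ∃ t0, t0 ∈ It' Tmax := by
    obtain ⟨q, hq0, hq1⟩ := exists_between hT
    refine ⟨q.toReal, ENNReal.toReal_pos hq0.ne' (ne_top_of_lt hq1), ?_⟩
    rwa [ENNReal.ofReal_toReal (ne_top_of_lt hq1)]
  constructor
  · intro T hTpos
    obtain ⟨C, hC, h⟩ := aux_conclude hab hsol M2 hM2 hB2n h0
      ((∫ x in a..b, (u x t0 + v x t0)) + |(M1 + M2) * (b - a)| * T) r hr1 hr2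
    refine ⟨C, hC, ?_⟩
    intro t1 ht1 ht1'
    have h1 : t1 ∈ It' Tmax := ⟨ht1, ht1'.trans_le (min_le_right _ _)⟩
    have hlt : t1 < T := (ENNReal.ofReal_lt_ofReal_iff hTpos).1 (ht1'.trans_le (min_le_left _ _))
    refine h t1 h1 ?_
    intro t ht
    have h2 := aux_mass_growth hab hsol M1 M2 hM1 hM2 h0 (aux_It'_mono h0 h1 ht) ht.1
    have h3 : (M1 + M2) * (b - a) * (t - t0) ≤ |(M1 + M2) * (b - a)| * T := by
      have h4 : t - t0 ≤ T := by linarith [ht.2, h0.1]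
      have h5 : 0 ≤ t - t0 := by linarith [ht.1]
      exact mul_le_mul (le_abs_self _) h4 h5 (abs_nonneg _)
    linarith
  · intro hH2
    obtain ⟨K, hK⟩ := aux_mass_uniform hab hsol M1 M2 hM1 hM2 hB2n hH2 h0
    obtain ⟨C, hC, h⟩ := aux_conclude hab hsol M2 hM2 hB2n h0 K r hr1 hr2
    refine ⟨C, hC, ?_⟩
    intro t1 h1
    exact h t1 h1 (fun t ht => hK t (aux_It'_mono h0 h1 ht) ht.1)
end
end
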